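/- arXiv:math/0411076 — 4 statements merged into one kernel-verified Lean document; each statement's English description precedes it below -/
import Mathlib

section
/- Let F be a free group and H a finitely generated subgroup of F of infinite index. Then there exists a nontrivial normal subgroup N of F such that N ∩ H = {1}. -/
namespace FreeGroup

theorem exists_letter_ne_three {X : Type*} [Nontrivial X] (p q r : X × Bool) :
    ∃ u : X × Bool, u ≠ p ∧ u ≠ q ∧ u ≠ r := by
  obtain ⟨x, y, hxy⟩ := exists_pair_ne X
  by_contra h
  have h (u : X × Bool) : u = p ∨ u = q ∨ u = r := by
    by_contra! hu
    exact h ⟨u, hu⟩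
  have h₁ := h (x, true)
  have h₂ := h (x, false)
  have h₃ := h (y, true)
  have h₄ := h (y, false)
  grind

theorem IsReduced.conj {X : Type*} {L : List (X × Bool)} (hL : IsReduced L) (hne : L ≠ [])
    {u : X × Bool} (hhead : u ≠ ((L.head hne).1, !(L.head hne).2))
    (hlast : u ≠ L.getLast hne) : IsReduced (u :: L ++ [(u.1, !u.2)]) := by
  unfold IsReduced at *
  rw [Ne, Prod.ext_iff] at hhead hlast
  rw [List.cons_append, List.isChain_cons, List.isChain_append]
  refine ⟨?_, hL, List.isChain_singleton _, ?_⟩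
  · rw [List.head?_append_of_ne_nil _ hne, List.head?_eq_some_head hne]
    grind
  · rw [List.getLast?_eq_some_getLast hne, List.head?_cons]
    rintro _ ⟨⟩ _ ⟨⟩ h
    rw [Bool.eq_not]
    exact fun hsign ↦ hlast ⟨h.symm, hsign.symm⟩

/-- In a free group of rank at least two, any two nontrivial elements have conjugates that do
not commute. -/
theorem exists_conj_not_commute {X : Type*} [Nontrivial X] {a b : FreeGroup X}
    (ha : a ≠ 1) (hb : b ≠ 1) :
    ∃ g h : FreeGroup X, ¬ Commute (g * a * g⁻¹) (h * b * h⁻¹) := by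
  classical
  have ha' : a.toWord ≠ [] := by simpa using ha
  have hb' : b.toWord ≠ [] := by simpa using hb
  obtain ⟨v, hv₁, hv₂, -⟩ := exists_letter_ne_three
    ((b.toWord.head hb').1, !(b.toWord.head hb').2) (b.toWord.getLast hb')
    (b.toWord.getLast hb')
  obtain ⟨u, hu₁, hu₂, huv⟩ := exists_letter_ne_three
    ((a.toWord.head ha').1, !(a.toWord.head ha').2) (a.toWord.getLast ha') v
  have hA := isReduced_toWord.conj ha' hu₁ hu₂
  have hB := isReduced_toWord.conj hb' hv₁ hv₂
  have conj_eq (c : FreeGroup X) (w : X × Bool) :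
      mk [w] * c * (mk [w])⁻¹ = mk (w :: c.toWord ++ [(w.1, !w.2)]) := by
    conv_lhs => rw [← mk_toWord (x := c)]
    simp [inv_mk, mul_mk, invRev]
  refine ⟨mk [u], mk [v], fun hc ↦ ?_⟩
  rw [conj_eq, conj_eq, commute_iff_eq, mul_mk, mul_mk] at hc
  have red {L M : List (X × Bool)} {w z : X × Bool} (hwz : w ≠ z)
      (hL : IsReduced (w :: L ++ [(w.1, !w.2)])) (hM : IsReduced (z :: M ++ [(z.1, !z.2)])) :
      IsReduced ((w :: L ++ [(w.1, !w.2)]) ++ (z :: M ++ [(z.1, !z.2)])) := by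
    unfold IsReduced at *
    rw [List.isChain_append]
    refine ⟨hL, hM, ?_⟩
    rw [Ne, Prod.ext_iff] at hwz
    rw [List.getLast?_concat, List.cons_append, List.head?_cons]
    rintro _ ⟨⟩ _ ⟨⟩ h
    rw [Bool.not_eq]
    exact fun hsign ↦ hwz ⟨h, hsign⟩
  have key := congrArg toWord hc
  rw [toWord_mk, toWord_mk, (red huv hA hB).reduce_eq, (red huv.symm hB hA).reduce_eq] at key
  simp at key
  exact huv key.1

end FreeGroup

theorem IsFreeGroup.isMulTorsionFree {G : Type*} [Group G] [IsFreeGroup G] :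
    IsMulTorsionFree G :=
  (IsFreeGroup.toFreeGroup G).injective.isMulTorsionFree
    (IsFreeGroup.toFreeGroup G).toMonoidHom

theorem Subgroup.inf_ne_bot_of_isCyclic {G : Type*} [Group G] [IsCyclic G] [IsMulTorsionFree G]
    {A B : Subgroup G} (hA : A ≠ ⊥) (hB : B ≠ ⊥) : A ⊓ B ≠ ⊥ := by
  obtain ⟨a, haA, ha⟩ := A.bot_or_exists_ne_one.resolve_left hA
  obtain ⟨b, hbB, hb⟩ := B.bot_or_exists_ne_one.resolve_left hB
  obtain ⟨z, hz⟩ := IsCyclic.exists_zpow_surjective (G := G)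
  obtain ⟨m, rfl⟩ := hz a
  obtain ⟨n, rfl⟩ := hz b
  intro h
  have hmem : z ^ (m * n) ∈ A ⊓ B :=
    ⟨by simpa [zpow_mul] using A.zpow_mem haA n,
      by simpa [mul_comm m n, zpow_mul] using B.zpow_mem hbB m⟩
  rw [h, Subgroup.mem_bot, zpow_mul] at hmem
  have hn : n ≠ 0 := by rintro rfl; simp at hb
  exact ha ((zpow_left_inj hn).1 (hmem.trans (one_zpow n).symm))

/-- Two nontrivial normal subgroups of a free group intersect nontrivially. -/
theorem Subgroup.inf_ne_bot_of_isFreeGroup {G : Type*} [Group G] [IsFreeGroup G]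
    {A B : Subgroup G} [A.Normal] [B.Normal] (hA : A ≠ ⊥) (hB : B ≠ ⊥) : A ⊓ B ≠ ⊥ := by
  have := IsFreeGroup.isMulTorsionFree (G := G)
  let e := IsFreeGroup.toFreeGroup G
  cases subsingleton_or_nontrivial (IsFreeGroup.Generators G) with
  | inl hs =>
    have : IsCyclic (FreeGroup (IsFreeGroup.Generators G)) := by
      cases isEmpty_or_nonempty (IsFreeGroup.Generators G) with
      | inl _ => infer_instance
      | inr _ =>
        have := Classical.choice (nonempty_unique (IsFreeGroup.Generators G))
        infer_instance
    have : IsCyclic G := isCyclic_of_surjective e.symm e.symm.surjective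
    exact inf_ne_bot_of_isCyclic hA hB
  | inr _ =>
    obtain ⟨a, haA, ha⟩ := A.bot_or_exists_ne_one.resolve_left hA
    obtain ⟨b, hbB, hb⟩ := B.bot_or_exists_ne_one.resolve_left hB
    obtain ⟨g, h, hgh⟩ := FreeGroup.exists_conj_not_commute
      (a := e a) (b := e b) (by simpa using ha) (by simpa using hb)
    intro hAB
    apply hgh
    have hcomm := Subgroup.commute_of_normal_of_disjoint A B inferInstance inferInstance
      (disjoint_iff.2 hAB) _ _ (Normal.conj_mem inferInstance a haA (e.symm g))
      (Normal.conj_mem inferInstance b hbB (e.symm h))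
    simpa using hcomm.map e

theorem Subgroup.iInf_ne_bot_of_isFreeGroup {G ι : Type*} [Group G] [IsFreeGroup G]
    [Nontrivial G] [Finite ι] (A : ι → Subgroup G) (hn : ∀ i, (A i).Normal)
    (hA : ∀ i, A i ≠ ⊥) : ⨅ i, A i ≠ ⊥ := by
  classical
  have := Fintype.ofFinite ι
  rw [← Finset.inf_univ_eq_iInf]
  suffices h : ∀ s : Finset ι, (s.inf A).Normal ∧ s.inf A ≠ ⊥ from (h _).2
  intro s
  induction s using Finset.induction with
  | empty => exact ⟨by rw [Finset.inf_empty]; infer_instance, by simp⟩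
  | insert i s _ ih =>
    have := hn i
    have := ih.1
    rw [Finset.inf_insert]
    exact ⟨inferInstance, inf_ne_bot_of_isFreeGroup (hA i) ih.2⟩

/-- A nontrivial subgroup of a free group normalized by a finite index subgroup has
nontrivial normal core. -/
theorem Subgroup.normalCore_ne_bot_of_isFreeGroup {G : Type*} [Group G] [IsFreeGroup G]
    {M K : Subgroup G} [K.FiniteIndex] (hK : ∀ k ∈ K, ∀ m ∈ M, k * m * k⁻¹ ∈ M)
    (hM : M ≠ ⊥) : M.normalCore ≠ ⊥ := by
  have := IsFreeGroup.isMulTorsionFree (G := G)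
  obtain ⟨m, hmM, hm⟩ := M.bot_or_exists_ne_one.resolve_left hM
  let A (q : G ⧸ K) : Subgroup K.normalCore :=
    (M.comap (MulAut.conj q.out⁻¹).toMonoidHom).subgroupOf K.normalCore
  have mem_A (q : G ⧸ K) (k : K.normalCore) : k ∈ A q ↔ q.out⁻¹ * k * q.out ∈ M := by
    simp [A, mem_subgroupOf]
  have hnormal (q : G ⧸ K) : (A q).Normal := ⟨fun n hn g ↦ by
    rw [mem_A] at hn ⊢
    have hg := hK _ (K.normalCore_le (K.normalCore_normal.conj_mem g g.2 q.out⁻¹)) _ hn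
    convert hg using 1
    simp
    group⟩
  have hne (q : G ⧸ K) : ∃ k ∈ A q, k ≠ 1 := by
    have hpow : (q.out * m * q.out⁻¹) ^ K.normalCore.index ∈ K.normalCore :=
      K.normalCore.pow_index_mem _
    rw [conj_pow] at hpow
    refine ⟨⟨_, hpow⟩, ?_, ?_⟩
    · rw [mem_A]
      simpa [mul_assoc] using M.pow_mem hmM _
    · rw [Ne, Subtype.ext_iff]
      simpa [FiniteIndex.index_ne_zero] using hm
  have : Nontrivial K.normalCore := by
    obtain ⟨k, -, hk⟩ := hne (1 : G)
    exact ⟨k, 1, hk⟩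
  obtain ⟨k, hkA, hk⟩ := (bot_or_exists_ne_one _).resolve_left
    (iInf_ne_bot_of_isFreeGroup A hnormal fun q hq ↦ by
      obtain ⟨k, hk, hk1⟩ := hne q
      exact hk1 (by simpa [hq] using hk))
  intro hbot
  have hcore : (k : G) ∈ M.normalCore := fun g ↦ by
    obtain ⟨l, hl⟩ := QuotientGroup.mk_out_eq_mul K g⁻¹
    have hmem := hK l l.2 _ ((mem_A _ k).1 ((mem_iInf.1 hkA) (g⁻¹ : G)))
    rw [hl] at hmem
    convert hmem using 1
    group
  rw [hbot, mem_bot] at hcore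
  exact hk (Subtype.ext hcore)

/-- A group action restricted to a finite set extends, for each group element, to a permutation
of that set. -/
theorem MulAction.exists_perm_extending_smul {G Q : Type*} [Group G] [MulAction G Q]
    (S : Finset Q) (x : G) :
    ∃ e : Equiv.Perm S, ∀ q : S, x • (q : Q) ∈ S → (e q : Q) = x • (q : Q) := by
  obtain ⟨e, he⟩ := Set.MapsTo.exists_equiv_extend_of_card_eq (α := S) (t := S)
    (Fintype.card_coe S) (s := {q | x • (q : Q) ∈ S}) (f := fun q ↦ x • (q : Q))
    (fun _ h ↦ h) (fun _ _ _ _ h ↦ Subtype.ext (smul_left_cancel x h))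
  exact ⟨e, he⟩

/-- A permutation of `G ⧸ H` lifts to a permutation of `G` commuting with right translations
by `H`, with prescribed left multipliers on each coset. -/
def Subgroup.liftPerm {G : Type*} [Group G] (H : Subgroup G) (e : Equiv.Perm (G ⧸ H))
    (c : G ⧸ H → G) (hc : ∀ q, c q • q = e q) : Equiv.Perm G where
  toFun f := c f * f
  invFun f := (c (e.symm f))⁻¹ * f
  left_inv f := by
    have h : ((c f * f : G) : G ⧸ H) = e f := hc f
    simp [h]
  right_inv f := by
    have h : (((c (e.symm f))⁻¹ * f : G) : G ⧸ H) = e.symm f := by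
      change (c (e.symm f))⁻¹ • (f : G ⧸ H) = _
      rw [inv_smul_eq_iff, hc, e.apply_symm_apply]
    simp [h]

/-- For a finite set `S` of cosets of `H`, the free group acts on its underlying set so that the
action commutes with right translations by `H`, induces a finite group of permutations of the
cosets, and agrees with left multiplication for each generator that stays inside `S`. -/
theorem FreeGroup.exists_hom_perm {X : Type*} (H : Subgroup (FreeGroup X))
    (S : Finset (FreeGroup X ⧸ H)) :
    ∃ (ρ : FreeGroup X →* Equiv.Perm (FreeGroup X))
      (ε : FreeGroup X →* Equiv.Perm (FreeGroup X ⧸ H)),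
      (ε.ker).FiniteIndex ∧
      (∀ g f, (ρ g f : FreeGroup X ⧸ H) = ε g f) ∧
      (∀ g f, ∀ h ∈ H, ρ g (f * h) = ρ g f * h) ∧
      ∀ x (f : FreeGroup X), (f : FreeGroup X ⧸ H) ∈ S →
        ((of x * f : FreeGroup X) : FreeGroup X ⧸ H) ∈ S → ρ (of x) f = of x * f := by
  classical
  choose e he using fun x : X ↦ MulAction.exists_perm_extending_smul S (of x)
  have hc (x : X) (q : FreeGroup X ⧸ H) : ∃ c : FreeGroup X,
      c • q = Equiv.Perm.ofSubtype (e x) q ∧ (q ∈ S → of x • q ∈ S → c = of x) := by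
    by_cases h : q ∈ S ∧ of x • q ∈ S
    · refine ⟨of x, ?_, fun _ _ ↦ rfl⟩
      rw [Equiv.Perm.ofSubtype_apply_of_mem (e x) h.1]
      exact (he x ⟨q, h.1⟩ h.2).symm
    · obtain ⟨c, hc⟩ := MulAction.exists_smul_eq (FreeGroup X) q (Equiv.Perm.ofSubtype (e x) q)
      exact ⟨c, hc, fun h₁ h₂ ↦ absurd ⟨h₁, h₂⟩ h⟩
  choose c hc hcS using hc
  let σ (x : X) := H.liftPerm (Equiv.Perm.ofSubtype (e x)) (c x) (hc x)
  let ε := (Equiv.Perm.ofSubtype (p := (· ∈ S))).comp (lift e)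
  have hquot (g f : FreeGroup X) : ((lift σ g f : FreeGroup X) : FreeGroup X ⧸ H) = ε g f := by
    have hgen (x : X) (f : FreeGroup X) :
        ((σ x f : FreeGroup X) : FreeGroup X ⧸ H) = Equiv.Perm.ofSubtype (e x) f := hc x f
    induction g using FreeGroup.induction_on generalizing f with
    | C1 => simp
    | of x => simpa [ε] using hgen x f
    | inv_of x _ =>
      rw [_root_.map_inv, _root_.map_inv, Equiv.Perm.eq_inv_iff_eq]
      simpa [ε] using (hgen x ((σ x)⁻¹ f)).symm
    | mul g₁ g₂ ih₁ ih₂ => simp [ih₁, ih₂]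
  have hequiv (g f h : FreeGroup X) (hh : h ∈ H) : lift σ g (f * h) = lift σ g f * h := by
    have hgen (x : X) (f : FreeGroup X) : σ x (f * h) = σ x f * h := by
      have : ((f * h : FreeGroup X) : FreeGroup X ⧸ H) = f := QuotientGroup.mk_mul_of_mem f hh
      simp [σ, Subgroup.liftPerm, this, mul_assoc]
    induction g using FreeGroup.induction_on generalizing f with
    | C1 => simp
    | of x => simpa using hgen x f
    | inv_of x _ =>
      rw [_root_.map_inv, Equiv.Perm.inv_eq_iff_eq]
      simpa using (hgen x ((σ x)⁻¹ f)).symm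
    | mul g₁ g₂ ih₁ ih₂ => simp [ih₁, ih₂]
  refine ⟨lift σ, ε, ?_, hquot, hequiv, fun x f hf hxf ↦ ?_⟩
  · have : (lift e).ker.FiniteIndex := Subgroup.finiteIndex_ker _
    refine Subgroup.finiteIndex_of_le (H := (lift e).ker) fun g hg ↦ ?_
    rw [MonoidHom.mem_ker] at hg ⊢
    simp [ε, hg]
  · simp [σ, Subgroup.liftPerm, hcS x f hf hxf]

/-- A finitely generated subgroup of a free group meets trivially a subgroup `M` normalized by a
finite index subgroup `K` such that every element of `K` lies in `H * M`. -/
theorem FreeGroup.exists_finiteIndex_complement {X : Type*} {H : Subgroup (FreeGroup X)}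
    (hfg : H.FG) :
    ∃ M K : Subgroup (FreeGroup X), K.FiniteIndex ∧
      (∀ k ∈ K, ∀ m ∈ M, k * m * k⁻¹ ∈ M) ∧ M ⊓ H = ⊥ ∧
      ∀ k ∈ K, ∃ h ∈ H, h⁻¹ * k ∈ M := by
  classical
  obtain ⟨T, rfl⟩ := hfg
  set H := Subgroup.closure (T : Set (FreeGroup X))
  let S : Finset (FreeGroup X ⧸ H) :=
    T.biUnion fun t ↦
      (t.toWord.tails.map fun l ↦ ((mk l : FreeGroup X) : FreeGroup X ⧸ H)).toFinset
  have hS {t : FreeGroup X} (ht : t ∈ T) {l : List (X × Bool)} (hl : l <:+ t.toWord) :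
      ((mk l : FreeGroup X) : FreeGroup X ⧸ H) ∈ S := by
    simp only [S, Finset.mem_biUnion, List.mem_toFinset, List.mem_map, List.mem_tails]
    exact ⟨t, ht, l, hl, rfl⟩
  obtain ⟨ρ, ε, hfin, hquot, hequiv, hρ⟩ := exists_hom_perm H S
  have hsuffix {t : FreeGroup X} (ht : t ∈ T) (l : List (X × Bool)) (hl : l <:+ t.toWord) :
      ρ (mk l) 1 = mk l := by
    induction l with
    | nil => simp [← one_eq_mk]
    | cons p l ih =>
      have hl' : l <:+ t.toWord := (List.suffix_cons p l).trans hl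
      have hcons : mk (p :: l) = mk [p] * mk l := by simp [mul_mk]
      have hSl := hS ht hl'
      have hSpl := hS ht hl
      rw [hcons] at hSpl ⊢
      rw [_root_.map_mul, Equiv.Perm.mul_apply, ih hl']
      obtain ⟨x, _ | _⟩ := p
      · have hinv : mk [(x, false)] = (of x)⁻¹ := by simp [of, inv_mk, invRev]
        rw [hinv] at hSpl ⊢
        rw [_root_.map_inv, Equiv.Perm.inv_eq_iff_eq, hρ x _ hSpl (by simpa using hSl)]
        simp
      · exact hρ x _ hSl hSpl
  have hmul {g h : FreeGroup X} (hh : ρ h 1 = h) (hH : h ∈ H) : ρ (g * h) 1 = ρ g 1 * h := by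
    rw [_root_.map_mul, Equiv.Perm.mul_apply, hh]
    simpa using hequiv g 1 h hH
  have hρH (h : FreeGroup X) (hh : h ∈ H) : ρ h 1 = h := by
    induction hh using Subgroup.closure_induction with
    | mem t ht => simpa only [mk_toWord] using hsuffix ht t.toWord List.suffix_rfl
    | one => simp
    | mul g h hg hh ihg ihh => rw [hmul ihh hh, ihg]
    | inv h hh ih =>
      rw [_root_.map_inv, Equiv.Perm.inv_eq_iff_eq]
      simpa [ih] using (hequiv h 1 h⁻¹ (inv_mem hh)).symm
  let M := (MulAction.stabilizer (Equiv.Perm (FreeGroup X)) (1 : FreeGroup X)).comap ρ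
  let K := (MulAction.stabilizer (Equiv.Perm (FreeGroup X ⧸ H))
    ((1 : FreeGroup X) : FreeGroup X ⧸ H)).comap ε
  have mem_M (g : FreeGroup X) : g ∈ M ↔ ρ g 1 = 1 := Iff.rfl
  have mem_K (g : FreeGroup X) : g ∈ K ↔ ρ g 1 ∈ H := by
    rw [show g ∈ K ↔ ε g ((1 : FreeGroup X) : FreeGroup X ⧸ H) = (1 : FreeGroup X) from Iff.rfl,
      ← hquot, eq_comm, QuotientGroup.eq]
    simp
  refine ⟨M, K, ?_, fun k hk m hm ↦ ?_, ?_, fun k hk ↦ ?_⟩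
  · refine Subgroup.finiteIndex_of_le (H := ε.ker) fun g hg ↦ ?_
    rw [MonoidHom.mem_ker] at hg
    simp [K, hg]
  · rw [mem_M] at hm ⊢
    have hk' := (mem_K _).1 (inv_mem hk)
    have hmk := hequiv m 1 _ hk'
    rw [one_mul, hm, one_mul] at hmk
    simp only [_root_.map_mul, Equiv.Perm.mul_apply, hmk]
    simp
  · rw [eq_bot_iff]
    rintro g ⟨hgM, hgH⟩
    exact (hρH g hgH).symm.trans hgM
  · have hk' := (mem_K k).1 hk
    refine ⟨ρ k 1, hk', ?_⟩
    rw [mem_M, _root_.map_mul, _root_.map_inv, Equiv.Perm.mul_apply, Equiv.Perm.inv_eq_iff_eq, hρH _ hk']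

theorem FreeGroup.exists_normal_inf_eq_bot {X : Type*} {H : Subgroup (FreeGroup X)}
    (hfg : H.FG) (hinf : H.index = 0) :
    ∃ N : Subgroup (FreeGroup X), N.Normal ∧ N ≠ ⊥ ∧ N ⊓ H = ⊥ := by
  obtain ⟨M, K, hK, hconj, hMH, hcompl⟩ := exists_finiteIndex_complement hfg
  refine ⟨M.normalCore, inferInstance,
    Subgroup.normalCore_ne_bot_of_isFreeGroup hconj fun hM ↦ ?_,
    eq_bot_mono (inf_le_inf_right H M.normalCore_le) hMH⟩
  have hKH : K ≤ H := fun k hk ↦ by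
    obtain ⟨h, hh, hhk⟩ := hcompl k hk
    rw [hM, Subgroup.mem_bot, inv_mul_eq_one] at hhk
    exact hhk ▸ hh
  exact (Subgroup.finiteIndex_of_le hKH).index_ne_zero hinf

/-- Karrass–Solitar: a finitely generated subgroup of infinite index in a free
group avoids some nontrivial normal subgroup. -/
theorem stmt_0 {F : Type*} [Group F] [IsFreeGroup F] (H : Subgroup F)
    (hfg : H.FG) (hinf : Infinite (F ⧸ H)) :
    ∃ N : Subgroup F, N.Normal ∧ N ≠ ⊥ ∧ N ⊓ H = ⊥ := by
  let e := IsFreeGroup.toFreeGroup F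
  have hfg' : (H.map e.toMonoidHom).FG := (Subgroup.fg_iff_submonoid_fg _).2
    (((Subgroup.fg_iff_submonoid_fg H).1 hfg).map e.toMonoidHom)
  obtain ⟨N, hN, hne, hNH⟩ := FreeGroup.exists_normal_inf_eq_bot hfg'
    (by
      rw [show (H.map e.toMonoidHom).index = H.index from H.index_map_equiv e]
      exact Subgroup.index_eq_zero_iff_infinite.2 hinf)
  refine ⟨N.comap e.toMonoidHom, inferInstance, fun h ↦ hne ?_, ?_⟩
  · rw [← Subgroup.map_comap_eq_self_of_surjective (f := e.toMonoidHom) e.surjective N, h,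
      Subgroup.map_bot]
  · rw [eq_bot_iff]
    rintro g ⟨hgN, hgH⟩
    have hg : e g ∈ N ⊓ H.map e.toMonoidHom := ⟨hgN, Subgroup.mem_map_of_mem _ hgH⟩
    rw [hNH, Subgroup.mem_bot] at hg
    simpa using hg
end

section
/- (M. Hall) Let F be a free group and H a finitely generated subgroup of F. Then H is a free factor of a subgroup of finite index: there exist a subgroup K of F containing H with [F : K] finite and a subgroup Q of K such that the natural homomorphism from the free product H ∗ Q to K (induced by the two inclusions) is an isomorphism. -/
/-- A permutation `e` induces a partial injection of a finite set `A` into itself, which extends to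
a permutation of `A`. -/
theorem Finset.exists_perm_extending_perm {β : Type*} (A : Finset β) (e : Equiv.Perm β) :
    ∃ σ : Equiv.Perm A, ∀ a : A, e a ∈ A → (σ a : β) = e a := by
  obtain ⟨σ, hσ⟩ := Set.MapsTo.exists_equiv_extend_of_card_eq (α := A) (t := A) (by simp)
    (s := {a : A | e a ∈ A}) (f := fun a => e a) (fun a ha => ha)
    (fun a _ b _ h => Subtype.ext (e.injective h))
  exact ⟨σ, hσ⟩

namespace FreeGroupBasis

variable {ι F : Type*} [Group F]

theorem closure_range (b : FreeGroupBasis ι F) : Subgroup.closure (Set.range b) = ⊤ := by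
  have h : Set.range b = b.repr.symm.toMonoidHom '' Set.range FreeGroup.of := by
    rw [← Set.range_comp]
    rfl
  rw [h, ← MonoidHom.map_closure, FreeGroup.closure_range_of, ← MonoidHom.range_eq_map]
  exact MonoidHom.range_eq_top.2 b.repr.symm.surjective

/-- For an action of a free group, the values of a cocycle may be prescribed on a basis. -/
theorem exists_cocycle (b : FreeGroupBasis ι F) {A G : Type*} [Group G]
    (ρ : F →* Equiv.Perm A) (c : ι → A → G) :
    ∃ C : F → A → G, (∀ v w a, C (v * w) a = C v (ρ w a) * C w a) ∧ ∀ i, C (b i) = c i := by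
  let ψ : F →* Equiv.Perm (A × G) := b.lift fun i =>
    { toFun := fun p => (ρ (b i) p.1, c i p.1 * p.2)
      invFun := fun p => ((ρ (b i))⁻¹ p.1, (c i ((ρ (b i))⁻¹ p.1))⁻¹ * p.2)
      left_inv := fun p => by simp
      right_inv := fun p => by simp }
  have hψb (i : ι) (p : A × G) : ψ (b i) p = (ρ (b i) p.1, c i p.1 * p.2) := by
    simp only [ψ, FreeGroupBasis.lift_apply_apply, FreeGroupBasis.repr_apply_coe,
      FreeGroup.lift_apply_of]
    rfl
  have hψ (w : F) : ∀ a g, ψ w (a, g) = (ρ w a, (ψ w (a, 1)).2 * g) := by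
    have hw : w ∈ Subgroup.closure (Set.range b) := b.closure_range ▸ Subgroup.mem_top w
    induction hw using Subgroup.closure_induction with
    | mem x hx =>
      obtain ⟨i, rfl⟩ := hx
      simp [hψb]
    | one => simp
    | mul x y _ _ hx hy =>
      intro a g
      simp only [map_mul, Equiv.Perm.mul_apply]
      rw [hy a g, hx, hy a 1, hx _ ((ψ y (a, 1)).2 * 1)]
      simp [mul_assoc]
    | inv x _ hx =>
      intro a g
      have key (g : G) : ψ x⁻¹ (a, g) =
          ((ρ x)⁻¹ a, (ψ x ((ρ x)⁻¹ a, 1)).2⁻¹ * g) := by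
        rw [map_inv, Equiv.Perm.inv_eq_iff_eq, hx]
        simp
      rw [key, key 1]
      simp
  refine ⟨fun w a => (ψ w (a, 1)).2, fun v w a => ?_, fun i => ?_⟩
  · simp only [map_mul, Equiv.Perm.mul_apply]
    rw [hψ w a 1, hψ v]
  · funext a
    simp [hψb]

/-- `b.TracedIn H A w` says that `w` can be written as a word in the basis `b` and its inverses all
of whose suffixes represent cosets belonging to `A`. -/
inductive TracedIn (b : FreeGroupBasis ι F) (H : Subgroup F) (A : Finset (F ⧸ H)) : F → Prop
  | one : ((1 : F) : F ⧸ H) ∈ A → TracedIn b H A 1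
  | mul (i : ι) (w : F) : TracedIn b H A w → ((b i * w : F) : F ⧸ H) ∈ A →
      TracedIn b H A (b i * w)
  | inv_mul (i : ι) (w : F) : TracedIn b H A w → (((b i)⁻¹ * w : F) : F ⧸ H) ∈ A →
      TracedIn b H A ((b i)⁻¹ * w)

variable {b : FreeGroupBasis ι F} {H : Subgroup F} {A B : Finset (F ⧸ H)} {w : F}

theorem TracedIn.coe_mem (h : b.TracedIn H A w) : (w : F ⧸ H) ∈ A := by
  cases h <;> assumption

theorem TracedIn.mono (hAB : A ⊆ B) (h : b.TracedIn H A w) : b.TracedIn H B w := by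
  induction h with
  | one h => exact .one (hAB h)
  | mul i w _ h ih => exact .mul i w ih (hAB h)
  | inv_mul i w _ h ih => exact .inv_mul i w ih (hAB h)

variable (b H) in
theorem exists_finset_tracedIn (w : F) :
    ∃ A : Finset (F ⧸ H), b.TracedIn H A w ∧
      ∀ a ∈ A, ∃ v : F, b.TracedIn H A v ∧ (v : F ⧸ H) = a := by
  classical
  have step (A : Finset (F ⧸ H)) (v : F)
      (hA : ∀ a ∈ A, ∃ v : F, b.TracedIn H A v ∧ (v : F ⧸ H) = a)
      (hv : b.TracedIn H (insert (v : F ⧸ H) A) v) :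
      ∃ A : Finset (F ⧸ H), b.TracedIn H A v ∧
        ∀ a ∈ A, ∃ v : F, b.TracedIn H A v ∧ (v : F ⧸ H) = a := by
    refine ⟨insert (v : F ⧸ H) A, hv, fun a ha => ?_⟩
    rcases Finset.mem_insert.1 ha with rfl | ha
    · exact ⟨v, hv, rfl⟩
    · obtain ⟨u, hu, rfl⟩ := hA a ha
      exact ⟨u, hu.mono (Finset.subset_insert _ _), rfl⟩
  have hw : w ∈ Subgroup.closure (Set.range b) := b.closure_range ▸ Subgroup.mem_top w
  induction hw using Subgroup.closure_induction_left with
  | one => exact step ∅ 1 (by simp) (.one (by simp))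
  | mul_left x hx y _ ih =>
    obtain ⟨i, rfl⟩ := hx
    obtain ⟨A, hy, hA⟩ := ih
    exact step A _ hA (.mul i y (hy.mono (Finset.subset_insert _ _)) (by simp))
  | inv_mul_cancel x hx y _ ih =>
    obtain ⟨i, rfl⟩ := hx
    obtain ⟨A, hy, hA⟩ := ih
    exact step A _ hA (.inv_mul i y (hy.mono (Finset.subset_insert _ _)) (by simp))

variable (b H) in
theorem exists_finset_forall_tracedIn (S : Finset F) :
    ∃ A : Finset (F ⧸ H), b.TracedIn H A 1 ∧ (∀ s ∈ S, b.TracedIn H A s) ∧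
      ∀ a ∈ A, ∃ v : F, b.TracedIn H A v ∧ (v : F ⧸ H) = a := by
  classical
  choose A hA hA' using exists_finset_tracedIn b H
  have hsub {s : F} (hs : s ∈ insert 1 S) : A s ⊆ (insert 1 S).biUnion A :=
    Finset.subset_biUnion_of_mem A hs
  refine ⟨(insert 1 S).biUnion A, (hA 1).mono (hsub (by simp)),
    fun s hs => (hA s).mono (hsub (by simp [hs])), fun a ha => ?_⟩
  obtain ⟨s, hs, has⟩ := Finset.mem_biUnion.1 ha
  obtain ⟨v, hv, rfl⟩ := hA' s a has
  exact ⟨v, hv.mono (hsub hs), rfl⟩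

/-- If each basis element acts on `A` by a permutation that agrees, where possible, with left
multiplication of cosets, then traced elements move the base point as they do in `F ⧸ H`. -/
theorem TracedIn.apply_eq {ρ : F →* Equiv.Perm A}
    (hρ : ∀ i (a : A), b i • (a : F ⧸ H) ∈ A → (ρ (b i) a : F ⧸ H) = b i • (a : F ⧸ H))
    {a₀ : A} (ha₀ : (a₀ : F ⧸ H) = (1 : F)) (h : b.TracedIn H A w) :
    (ρ w a₀ : F ⧸ H) = w := by
  induction h with
  | one _ => simpa using ha₀
  | mul i w hw h ih =>
    rw [map_mul, Equiv.Perm.mul_apply, hρ, ih]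
    · rfl
    · rw [ih]; exact h
  | inv_mul i w hw h ih =>
    have hmul : b i • (((b i)⁻¹ * w : F) : F ⧸ H) = w :=
      congrArg (QuotientGroup.mk (s := H)) (mul_inv_cancel_left (b i) w)
    have : ρ (b i) ⟨_, h⟩ = ρ w a₀ := Subtype.ext <| by
      rw [hρ _ _ (by rw [hmul]; exact hw.coe_mem), ih, hmul]
    rw [map_mul, Equiv.Perm.mul_apply, ← this, map_inv, ← Equiv.Perm.mul_apply, inv_mul_cancel,
      Equiv.Perm.one_apply]

/-- A cocycle whose values on the edges of the partial Schreier graph lie in a subgroup `N` takes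
values in `N` on all traced elements. -/
theorem TracedIn.cocycle_mem {ρ : F →* Equiv.Perm A}
    (hρ : ∀ i (a : A), b i • (a : F ⧸ H) ∈ A → (ρ (b i) a : F ⧸ H) = b i • (a : F ⧸ H))
    {a₀ : A} (ha₀ : (a₀ : F ⧸ H) = (1 : F)) {G : Type*} [Group G] {C : F → A → G}
    (hC : ∀ v w a, C (v * w) a = C v (ρ w a) * C w a) {N : Subgroup G}
    (hN : ∀ i (a : A), b i • (a : F ⧸ H) ∈ A → C (b i) a ∈ N) (h : b.TracedIn H A w) :
    C w a₀ ∈ N := by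
  have hC1 (a : A) : C 1 a = 1 := by simpa using hC 1 1 a
  induction h with
  | one _ => rw [hC1]; exact N.one_mem
  | mul i w hw h ih =>
    rw [hC]
    refine N.mul_mem (hN _ _ ?_) ih
    rw [hw.apply_eq hρ ha₀]
    exact h
  | inv_mul i w hw h ih =>
    have h' := hC (b i) ((b i)⁻¹ * w) a₀
    rw [mul_inv_cancel_left] at h'
    refine (N.mul_mem_cancel_left (hN i _ ?_)).1 (h' ▸ ih)
    rw [(TracedIn.inv_mul i w hw h).apply_eq hρ ha₀]
    have hmul : b i • (((b i)⁻¹ * w : F) : F ⧸ H) = w :=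
      congrArg (QuotientGroup.mk (s := H)) (mul_inv_cancel_left (b i) w)
    rw [hmul]
    exact hw.coe_mem

end FreeGroupBasis

/-- M. Hall: a finitely generated subgroup of a free group is a free factor of a
subgroup of finite index. -/
theorem stmt_1 {F : Type*} [Group F] [IsFreeGroup F] (H : Subgroup F) (hfg : H.FG) :
    ∃ K : Subgroup F, H ≤ K ∧ K.FiniteIndex ∧
      ∃ Q : Subgroup K,
        Function.Bijective
          (Monoid.Coprod.lift (H.subgroupOf K).subtype Q.subtype) := by
  classical
  obtain ⟨S, hS⟩ := hfg
  let b := IsFreeGroup.basis F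
  obtain ⟨A, hA1, hAS, hA⟩ := b.exists_finset_forall_tracedIn H S
  choose σ hσ using fun i => A.exists_perm_extending_perm (MulAction.toPerm (b i))
  let ρ : F →* Equiv.Perm A := b.lift σ
  have hρ (i) (a : A) (h : b i • (a : F ⧸ H) ∈ A) : (ρ (b i) a : F ⧸ H) = b i • (a : F ⧸ H) := by
    rw [FreeGroupBasis.lift_apply_apply, FreeGroupBasis.repr_apply_coe, FreeGroup.lift_apply_of]
    exact hσ i a h
  let a₀ : A := ⟨((1 : F) : F ⧸ H), hA1.coe_mem⟩
  have ha₀ : (a₀ : F ⧸ H) = (1 : F) := rfl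
  -- Coset representatives that can be traced in `A`.
  obtain ⟨t, ht₀, ht, htA⟩ : ∃ t : A → F, t a₀ = 1 ∧ (∀ a, b.TracedIn H A (t a)) ∧
      ∀ a, (t a : F ⧸ H) = a := by
    choose t ht using fun a : A => hA a a.2
    refine ⟨Function.update t a₀ 1, by simp, fun a => ?_, fun a => ?_⟩ <;>
    · rcases eq_or_ne a a₀ with rfl | ha
      · simp [hA1, ha₀]
      · simp [ha, ht a]
  have hta (a : A) : ρ (t a) a₀ = a := Subtype.ext (((ht a).apply_eq hρ ha₀).trans (htA a))
  let K : Subgroup F := (MulAction.stabilizer (Equiv.Perm A) a₀).comap ρ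
  have hK (w : F) : w ∈ K ↔ ρ w a₀ = a₀ := Iff.rfl
  let e (i) (a : A) : K := ⟨(t (ρ (b i) a))⁻¹ * (b i * t a), by
    rw [hK, map_mul, map_mul, Equiv.Perm.mul_apply, Equiv.Perm.mul_apply, hta, map_inv,
      Equiv.Perm.inv_eq_iff_eq, hta]⟩
  have he (i) (a : A) (h : b i • (a : F ⧸ H) ∈ A) : e i a ∈ H.subgroupOf K := by
    rw [Subgroup.mem_subgroupOf, ← QuotientGroup.eq, htA, hρ i a h]
    exact congrArg (b i • ·) (htA a).symm
  let Q : Subgroup K := Subgroup.closure {k | k ∉ H.subgroupOf K ∧ ∃ i a, e i a = k}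
  let c (i) (a : A) : Monoid.Coprod (H.subgroupOf K) Q :=
    if h : e i a ∈ H.subgroupOf K then Monoid.Coprod.inl ⟨e i a, h⟩
    else Monoid.Coprod.inr ⟨e i a, Subgroup.subset_closure ⟨h, i, a, rfl⟩⟩
  let L : Monoid.Coprod (H.subgroupOf K) Q →* K :=
    Monoid.Coprod.lift (H.subgroupOf K).subtype Q.subtype
  have hLc (i) (a : A) : L (c i a) = e i a := by
    simp only [c]
    split_ifs <;> simp [L]
  obtain ⟨C, hC, hCb⟩ := b.exists_cocycle ρ c
  have hC1 (a : A) : C 1 a = 1 := by simpa using hC 1 1 a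
  have hLC (w : F) : ∀ a, (L (C w a) : F) = (t (ρ w a))⁻¹ * (w * t a) := by
    have hw : w ∈ Subgroup.closure (Set.range b) := b.closure_range ▸ Subgroup.mem_top w
    induction hw using Subgroup.closure_induction with
    | mem x hx =>
      obtain ⟨i, rfl⟩ := hx
      intro a
      rw [hCb, hLc]
    | one => simp [hC1]
    | mul x y _ _ hx hy =>
      intro a
      rw [hC, map_mul, Subgroup.coe_mul, hx, hy, map_mul, Equiv.Perm.mul_apply]
      group
    | inv x _ hx =>
      intro a
      have h := hC x x⁻¹ a
      rw [mul_inv_cancel, hC1, eq_comm, mul_eq_one_iff_inv_eq] at h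
      rw [← h, map_inv, Subgroup.coe_inv, hx]
      simp [mul_assoc]
  let φ : K →* Monoid.Coprod (H.subgroupOf K) Q :=
    { toFun := fun k => C k a₀
      map_one' := hC1 a₀
      map_mul' := fun k l => by rw [Subgroup.coe_mul, hC, (hK l).1 l.2] }
  have hLφ (k : K) : L (φ k) = k := by
    refine Subtype.ext ((hLC k a₀).trans ?_)
    rw [(hK k).1 k.2, ht₀]
    simp
  let N : Subgroup (Monoid.Coprod (H.subgroupOf K) Q) :=
    (Monoid.Coprod.inl : H.subgroupOf K →* Monoid.Coprod (H.subgroupOf K) Q).range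
  have hLN {g} (hg : g ∈ N) : ∃ h : H.subgroupOf K, Monoid.Coprod.inl h = g ∧ L g = h := by
    obtain ⟨h, rfl⟩ := hg
    exact ⟨h, rfl, by simp [L]⟩
  have hN (w : F) (hw : b.TracedIn H A w) : C w a₀ ∈ N :=
    hw.cocycle_mem hρ ha₀ hC fun i a h => by
      rw [hCb]
      simp only [c, dif_pos (he i a h)]
      exact ⟨_, rfl⟩
  have hCt (a : A) : C (t a) a₀ = 1 := by
    obtain ⟨h, hh, hL⟩ := hLN (hN _ (ht a))
    have : (L (C (t a) a₀) : F) = 1 := by rw [hLC, hta, ht₀]; simp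
    rw [← hh, show h = 1 from Subtype.ext (hL.symm.trans (Subtype.ext this)), map_one]
  have hHmap : H ≤ (N.comap φ).map K.subtype := by
    refine hS.ge.trans ((Subgroup.closure_le _).2 ?_)
    intro s hs
    have hsH : (s : F ⧸ H) = (1 : F) := by
      rw [eq_comm, QuotientGroup.eq, inv_one, one_mul, ← hS]
      exact Subgroup.subset_closure hs
    exact ⟨⟨s, (hK s).2 (Subtype.ext (((hAS s hs).apply_eq hρ ha₀).trans hsH))⟩,
      hN s (hAS s hs), rfl⟩
  have hφH : φ.comp (H.subgroupOf K).subtype = Monoid.Coprod.inl := by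
    ext1 h
    obtain ⟨k, hk, hkh⟩ := hHmap (Subgroup.mem_subgroupOf.1 h.2)
    obtain rfl : k = h := Subtype.ext hkh
    obtain ⟨h', hh, hL⟩ := hLN hk
    rw [hLφ] at hL
    obtain rfl : h = h' := Subtype.ext hL
    exact hh.symm
  have hφQ : φ.comp Q.subtype = Monoid.Coprod.inr := by
    ext1 ⟨q, hq⟩
    induction hq using Subgroup.closure_induction with
    | mem x hx =>
      obtain ⟨hx, i, a, rfl⟩ := hx
      have h := hC (t (ρ (b i) a)) (e i a) a₀
      rw [(hK _).1 (e i a).2, hCt, one_mul, show t (ρ (b i) a) * (e i a : F) = b i * t a from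
        mul_inv_cancel_left _ _, hC, hCt, hta, mul_one, hCb] at h
      exact h.symm.trans (dif_neg hx)
    | one => exact (map_one (φ.comp Q.subtype)).trans (map_one Monoid.Coprod.inr).symm
    | mul x y hx hy ihx ihy =>
      have := congrArg₂ (· * ·) ihx ihy
      simp only [← map_mul] at this
      exact this
    | inv x hx ih =>
      have := congrArg (·⁻¹) ih
      simp only [← map_inv] at this
      exact this
  have hφL : φ.comp L = MonoidHom.id _ := by
    refine Monoid.Coprod.hom_ext ?_ ?_
    · rw [MonoidHom.comp_assoc, Monoid.Coprod.lift_comp_inl, hφH, MonoidHom.id_comp]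
    · rw [MonoidHom.comp_assoc, Monoid.Coprod.lift_comp_inr, hφQ, MonoidHom.id_comp]
  have hKfin : K.FiniteIndex :=
    ⟨(Subgroup.index_comap _ ρ).trans_ne Subgroup.FiniteIndex.index_ne_zero⟩
  refine ⟨K, hHmap.trans (Subgroup.map_subtype_le _), hKfin, Q, ?_⟩
  exact ⟨Function.LeftInverse.injective (g := φ) (DFunLike.congr_fun hφL),
    Function.RightInverse.surjective hLφ⟩
end

section
/- Let F be a free group and H a finitely generated subgroup of F of infinite index. Then H is a proper free factor of a finite-index subgroup: there exist a subgroup K of F containing H with [F : K] finite and a nontrivial subgroup Q of K such that the natural homomorphism from the free product H ∗ Q to K (induced by the two inclusions) is an isomorphism. -/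
open Monoid.Coprod in
/-- A two-sided inverse of the homomorphism `H ∗ P → K` induced by the inclusion of `H` and by `q`
shows that `K` is the internal free product of `H` and the range of `q`. -/
theorem bijective_lift_subgroupOf_range {F P : Type*} [Group F] [Group P] {H K : Subgroup F}
    (hHK : H ≤ K) (q : P →* K) (ψ : K →* Monoid.Coprod H P)
    (hl : ∀ h : H, ψ (Subgroup.inclusion hHK h) = inl h) (hr : ∀ y, ψ (q y) = inr y)
    (hφψ : ∀ k, lift (Subgroup.inclusion hHK) q (ψ k) = k) :
    Function.Bijective (lift (H.subgroupOf K).subtype q.range.subtype) := by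
  let π : Monoid.Coprod H P →* Monoid.Coprod (H.subgroupOf K) q.range :=
    map (Subgroup.subgroupOfEquivOfLe hHK).symm.toMonoidHom q.rangeRestrict
  have hπ : Function.Surjective π := by
    intro a
    induction a using Monoid.Coprod.induction_on with
    | inl h =>
      obtain ⟨h, rfl⟩ := (Subgroup.subgroupOfEquivOfLe hHK).symm.surjective h
      exact ⟨inl h, rfl⟩
    | inr y =>
      obtain ⟨y, rfl⟩ := q.rangeRestrict_surjective y
      exact ⟨inr y, rfl⟩
    | mul a b ha hb =>
      obtain ⟨a, rfl⟩ := ha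
      obtain ⟨b, rfl⟩ := hb
      exact ⟨a * b, map_mul π a b⟩
  have hcomp : (lift (H.subgroupOf K).subtype q.range.subtype).comp π =
      lift (Subgroup.inclusion hHK) q := by
    ext <;> rfl
  have hψφ : ψ.comp (lift (Subgroup.inclusion hHK) q) = MonoidHom.id _ := by
    refine hom_ext (MonoidHom.ext fun h => ?_) (MonoidHom.ext fun y => ?_)
    · simpa using hl h
    · simpa using hr y
  have key : ∀ a, lift (H.subgroupOf K).subtype q.range.subtype (π a) =
      lift (Subgroup.inclusion hHK) q a := fun a => DFunLike.congr_fun hcomp a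
  refine ⟨fun a b hab => ?_, fun k => ⟨π (ψ k), by rw [key, hφψ]⟩⟩
  obtain ⟨a, rfl⟩ := hπ a
  obtain ⟨b, rfl⟩ := hπ b
  rw [key, key] at hab
  have := congrArg ψ hab
  rw [← MonoidHom.comp_apply, ← MonoidHom.comp_apply, hψφ] at this
  exact congrArg π this

/-- The product in `F` of a signed word in the basis `b`. -/
def FreeGroupBasis.wordProd {ι F : Type*} [Group F] (b : FreeGroupBasis ι F)
    (w : List (ι × Bool)) : F :=
  (w.map fun e => cond e.2 (b e.1) (b e.1)⁻¹).prod

theorem FreeGroupBasis.wordProd_surjective {ι F : Type*} [Group F] (b : FreeGroupBasis ι F) :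
    Function.Surjective b.wordProd := by
  classical
  intro g
  refine ⟨(b.repr g).toWord, ?_⟩
  have h : b.lift b g = g :=
    DFunLike.congr_fun (b.ext_hom (b.lift b) (MonoidHom.id F) fun i => by simp) g
  conv_rhs => rw [← h]
  rw [FreeGroupBasis.lift_apply_apply, ← FreeGroup.mk_toWord (x := b.repr g), FreeGroup.lift_mk]
  simp [wordProd]

theorem FreeGroupBasis.induction_on {ι F : Type*} [Group F] (b : FreeGroupBasis ι F)
    {p : F → Prop} (one : p 1) (of : ∀ x, p (b x)) (inv : ∀ g, p g → p g⁻¹)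
    (mul : ∀ g h, p g → p h → p (g * h)) (g : F) : p g := by
  obtain ⟨w, rfl⟩ := b.wordProd_surjective g
  induction w with
  | nil => exact one
  | cons e w ih =>
    obtain ⟨x, _ | _⟩ := e
    · exact mul (b x)⁻¹ _ (inv _ (of x)) ih
    · exact mul (b x) _ (of x) ih

section Cocycle

variable {F X C : Type*} [Group F] [Group C]

/-- The permutation action underlying a homomorphism to a permutational wreath product. -/
def wreathPerm (Ω : F →* (X → C) ⋊[mulAutArrow] Equiv.Perm X) : F →* Equiv.Perm X :=
  SemidirectProduct.rightHom.comp Ω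

/-- The cocycle of a homomorphism to a permutational wreath product: the label in `C` of the
path that starts at `v` and is described by `g`. -/
def wreathCocycle (Ω : F →* (X → C) ⋊[mulAutArrow] Equiv.Perm X) (g : F) (v : X) : C :=
  (Ω g).left (wreathPerm Ω g v)

variable (Ω : F →* (X → C) ⋊[mulAutArrow] Equiv.Perm X)

theorem wreathPerm_inv_apply (g : F) (v : X) : wreathPerm Ω g⁻¹ (wreathPerm Ω g v) = v := by
  rw [← Equiv.Perm.mul_apply, ← map_mul, inv_mul_cancel, map_one, Equiv.Perm.one_apply]

theorem wreathCocycle_one (v : X) : wreathCocycle Ω 1 v = 1 := by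
  simp [wreathCocycle]

theorem wreathCocycle_mul (g h : F) (v : X) :
    wreathCocycle Ω (g * h) v =
      wreathCocycle Ω g (wreathPerm Ω h v) * wreathCocycle Ω h v := by
  have : ((Ω g).right)⁻¹ ((Ω g).right ((Ω h).right v)) = (Ω h).right v := by simp
  simp only [wreathCocycle, wreathPerm, map_mul, SemidirectProduct.mul_left, Pi.mul_apply,
    MonoidHom.comp_apply, SemidirectProduct.rightHom_eq_right,
    Equiv.Perm.mul_apply, mul_right_inj]
  exact congrArg (Ω h).left this

theorem wreathCocycle_inv (g : F) (v : X) :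
    wreathCocycle Ω g⁻¹ (wreathPerm Ω g v) = (wreathCocycle Ω g v)⁻¹ := by
  rw [eq_inv_iff_mul_eq_one, ← wreathCocycle_mul, inv_mul_cancel, wreathCocycle_one]

/-- The homomorphism to the wreath product given by permutations and edge labels of a basis. -/
noncomputable def wreathLift {ι : Type*} (b : FreeGroupBasis ι F) (σ : ι → Equiv.Perm X)
    (ℓ : ι → X → C) : F →* (X → C) ⋊[mulAutArrow] Equiv.Perm X :=
  b.lift fun x => ⟨fun v => ℓ x ((σ x)⁻¹ v), σ x⟩

variable {ι : Type*} (b : FreeGroupBasis ι F) (σ : ι → Equiv.Perm X) (ℓ : ι → X → C)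

@[simp]
theorem wreathPerm_wreathLift (x : ι) : wreathPerm (wreathLift b σ ℓ) (b x) = σ x := by
  simp [wreathPerm, wreathLift]

@[simp]
theorem wreathCocycle_wreathLift (x : ι) (v : X) :
    wreathCocycle (wreathLift b σ ℓ) (b x) v = ℓ x v := by
  simp [wreathCocycle, wreathPerm, wreathLift]

end Cocycle

section Completion

variable {F ι X : Type*} [Group F] {H : Subgroup F} (b : FreeGroupBasis ι F)
  (σ : ι → Equiv.Perm X) (p : X → F ⧸ H) (t : X → F)

/-- The edges of the graph of `σ` that are not edges of the Schreier graph of `H`. -/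
abbrev NewEdge : Type _ := {e : ι × X // p (σ e.1 e.2) ≠ b e.1 • p e.2}

open Classical in
/-- Edges of the Schreier graph are labelled by the loop they close up, new edges by free
generators. -/
noncomputable def edgeLabel (ht : ∀ v, (t v : F ⧸ H) = p v) (x : ι) (v : X) :
    Monoid.Coprod H (FreeGroup (NewEdge b σ p)) :=
  if h : p (σ x v) = b x • p v then
    Monoid.Coprod.inl ⟨(t (σ x v))⁻¹ * (b x * t v), QuotientGroup.eq.1 <| by
      rw [ht, h, ← ht]; rfl⟩
  else Monoid.Coprod.inr (FreeGroup.of ⟨(x, v), h⟩)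

variable {b σ p t} (ht : ∀ v, (t v : F ⧸ H) = p v)

/-- The path described by `g` that starts at `v` stays in the Schreier graph of `H`. -/
def Follows (g : F) (v : X) : Prop :=
  p (wreathPerm (wreathLift b σ (edgeLabel b σ p t ht)) g v) = g • p v ∧
    ∃ h : H, wreathCocycle (wreathLift b σ (edgeLabel b σ p t ht)) g v = Monoid.Coprod.inl h ∧
      (h : F) = (t (wreathPerm (wreathLift b σ (edgeLabel b σ p t ht)) g v))⁻¹ * (g * t v)

theorem Follows.one (v : X) : Follows (b := b) (σ := σ) ht 1 v :=
  ⟨by simp, 1, by simp [wreathCocycle_one], by simp⟩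

theorem Follows.mul {g h : F} {v : X} (hh : Follows (b := b) (σ := σ) ht h v)
    (hg : Follows (b := b) (σ := σ) ht g
      (wreathPerm (wreathLift b σ (edgeLabel b σ p t ht)) h v)) :
    Follows (b := b) (σ := σ) ht (g * h) v := by
  obtain ⟨hh₁, kh, hh₂, hh₃⟩ := hh
  obtain ⟨hg₁, kg, hg₂, hg₃⟩ := hg
  refine ⟨?_, kg * kh, ?_, ?_⟩
  · rw [map_mul, Equiv.Perm.mul_apply, hg₁, hh₁, mul_smul]
  · rw [wreathCocycle_mul, hg₂, hh₂, map_mul]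
  · rw [Subgroup.coe_mul, hg₃, hh₃, map_mul, Equiv.Perm.mul_apply]
    group

theorem Follows.inv {g : F} {v : X} (hg : Follows (b := b) (σ := σ) ht g v) :
    Follows (b := b) (σ := σ) ht g⁻¹
      (wreathPerm (wreathLift b σ (edgeLabel b σ p t ht)) g v) := by
  obtain ⟨hg₁, k, hg₂, hg₃⟩ := hg
  refine ⟨?_, k⁻¹, ?_, ?_⟩
  · rw [wreathPerm_inv_apply, hg₁, inv_smul_smul]
  · rw [wreathCocycle_inv, hg₂, map_inv]
  · rw [Subgroup.coe_inv, hg₃, wreathPerm_inv_apply]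
    group

theorem follows_basis {x : ι} {v : X} (h : p (σ x v) = b x • p v) :
    Follows (b := b) (σ := σ) ht (b x) v := by
  refine ⟨by simpa using h, ⟨(t (σ x v))⁻¹ * (b x * t v), QuotientGroup.eq.1 <| by
    rw [ht, h, ← ht]; rfl⟩, ?_, by simp⟩
  rw [wreathCocycle_wreathLift, edgeLabel, dif_pos h]

/-- If `H` and the transversal `t` can be read off in the part of a finite graph that lies in the
Schreier graph of `H`, then `H` is a free factor of the fundamental group of the finite graph,
with a complement that is freely generated by the new edges. -/
theorem exists_finiteIndex_free_factor [Finite X] (hp : Function.Injective p) {v₀ : X}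
    (hv₀ : t v₀ = 1) (htf : ∀ v, Follows (b := b) (σ := σ) ht (t v) v₀) {S : Set F}
    (hS : Subgroup.closure S = H) (hSf : ∀ s ∈ S, Follows (b := b) (σ := σ) ht s v₀)
    (hE : Nonempty (NewEdge b σ p)) :
    ∃ K : Subgroup F, H ≤ K ∧ K.FiniteIndex ∧
      ∃ Q : Subgroup K, Q ≠ ⊥ ∧
        Function.Bijective
          (Monoid.Coprod.lift (H.subgroupOf K).subtype Q.subtype) := by
  set Ω := wreathLift b σ (edgeLabel b σ p t ht) with hΩ
  have hpv₀ : p v₀ = ((1 : F) : F ⧸ H) := by rw [← ht, hv₀]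
  have htv : ∀ v, wreathPerm Ω (t v) v₀ = v := fun v => hp <| by
    rw [(htf v).1, hpv₀, ← ht]
    exact congrArg _ (mul_one (t v))
  let K : Subgroup F := (MulAction.stabilizer (Equiv.Perm X) v₀).comap (wreathPerm Ω)
  have hK : K.FiniteIndex :=
    ⟨(Subgroup.index_comap _ (wreathPerm Ω)).symm ▸ Subgroup.FiniteIndex.index_ne_zero⟩
  have mem_K : ∀ {g}, g ∈ K ↔ wreathPerm Ω g v₀ = v₀ := Iff.rfl
  have hHf : ∀ h ∈ H, wreathPerm Ω h v₀ = v₀ ∧ Follows (b := b) (σ := σ) ht h v₀ := by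
    intro h hh
    rw [← hS] at hh
    induction hh using Subgroup.closure_induction with
    | mem s hs =>
      refine ⟨hp ?_, hSf s hs⟩
      rw [(hSf s hs).1, hpv₀]
      have hsH : s ∈ H := hS ▸ Subgroup.subset_closure hs
      exact QuotientGroup.eq.2 (by simpa using hsH)
    | one => exact ⟨by simp, Follows.one ht v₀⟩
    | mul g h _ _ hg hh =>
      refine ⟨by rw [map_mul, Equiv.Perm.mul_apply, hh.1, hg.1], hh.2.mul ht ?_⟩
      rw [← hΩ, hh.1]
      exact hg.2
    | inv g _ hg =>
      have := hg.2.inv ht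
      rw [← hΩ, hg.1] at this
      exact ⟨by rw [map_inv, Equiv.Perm.inv_eq_iff_eq, hg.1], this⟩
  have hHK : H ≤ K := fun h hh => mem_K.2 (hHf h hh).1
  have hcH : ∀ h : H, wreathCocycle Ω h v₀ = Monoid.Coprod.inl h := by
    intro h
    obtain ⟨h₁, -, k, h₂, h₃⟩ := hHf h h.2
    rw [h₂]
    congr 1
    ext
    rw [h₃, ← hΩ, h₁, hv₀]
    group
  have hct : ∀ v, wreathCocycle Ω (t v) v₀ = 1 := by
    intro v
    obtain ⟨-, k, h₂, h₃⟩ := htf v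
    rw [h₂, ← map_one Monoid.Coprod.inl]
    congr 1
    ext
    rw [h₃, ← hΩ, htv, hv₀]
    simp
  have hloop : ∀ g v, (t (wreathPerm Ω g v))⁻¹ * (g * t v) ∈ K := by
    intro g v
    rw [mem_K, map_mul, map_mul, map_inv, Equiv.Perm.mul_apply, Equiv.Perm.mul_apply, htv,
      Equiv.Perm.inv_eq_iff_eq, htv]
  have hcloop : ∀ g v, wreathCocycle Ω ((t (wreathPerm Ω g v))⁻¹ * (g * t v)) v₀ =
      wreathCocycle Ω g v := by
    intro g v
    have := wreathCocycle_inv Ω (t (wreathPerm Ω g v)) v₀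
    rw [htv, hct, inv_one] at this
    rw [wreathCocycle_mul, wreathCocycle_mul, hct, mul_one, map_mul, Equiv.Perm.mul_apply, htv,
      this, one_mul]
  let ψ : K →* Monoid.Coprod H (FreeGroup (NewEdge b σ p)) :=
    MonoidHom.mk' (fun k => wreathCocycle Ω k v₀) fun k l => by
      rw [Subgroup.coe_mul, wreathCocycle_mul, mem_K.1 l.2]
  let q : FreeGroup (NewEdge b σ p) →* K :=
    FreeGroup.lift fun e => ⟨_, hloop (b e.1.1) e.1.2⟩
  have hr : ∀ y, ψ (q y) = Monoid.Coprod.inr y := by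
    intro y
    refine DFunLike.congr_fun (f := ψ.comp q) (FreeGroup.ext_hom _ _ fun e => ?_) y
    rw [MonoidHom.comp_apply, FreeGroup.lift_apply_of]
    refine (hcloop _ _).trans ?_
    rw [hΩ, wreathCocycle_wreathLift, edgeLabel, dif_neg e.2]
  have hφ : ∀ g v, (Monoid.Coprod.lift (Subgroup.inclusion hHK) q (wreathCocycle Ω g v) : F) =
      (t (wreathPerm Ω g v))⁻¹ * (g * t v) := by
    intro g
    induction g using b.induction_on with
    | one => intro v; simp [wreathCocycle_one]
    | of x =>
      intro v
      rw [hΩ, wreathCocycle_wreathLift, wreathPerm_wreathLift, edgeLabel]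
      split_ifs with h
      · simp
      · rw [Monoid.Coprod.lift_apply_inr, FreeGroup.lift_apply_of]
        simp [hΩ]
    | inv g ih =>
      intro v
      obtain ⟨v, rfl⟩ := (wreathPerm Ω g).surjective v
      rw [wreathCocycle_inv, map_inv, Subgroup.coe_inv, ih, wreathPerm_inv_apply]
      group
    | mul g h ihg ihh =>
      intro v
      rw [wreathCocycle_mul, map_mul, Subgroup.coe_mul, ihg, ihh, map_mul, Equiv.Perm.mul_apply]
      group
  refine ⟨K, hHK, hK, q.range, fun hq => ?_,
    bijective_lift_subgroupOf_range hHK q ψ hcH hr fun k => Subtype.ext ?_⟩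
  · obtain ⟨e⟩ := hE
    have h₁ : q (FreeGroup.of e) = 1 := by
      rw [← Subgroup.mem_bot, ← hq]
      exact ⟨_, rfl⟩
    have h₂ := hr (FreeGroup.of e)
    rw [h₁, map_one] at h₂
    exact FreeGroup.of_ne_one e (Monoid.Coprod.inr_injective (h₂.symm.trans (map_one _).symm))
  · refine (hφ k v₀).trans ?_
    rw [mem_K.1 k.2, hv₀]
    group

end Completion

/-- A finitely generated subgroup of infinite index in a free group is a *proper*
free factor of a finite-index subgroup. -/
theorem stmt_2 {F : Type*} [Group F] [IsFreeGroup F] (H : Subgroup F)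
    (hfg : H.FG) (hinf : Infinite (F ⧸ H)) :
    ∃ K : Subgroup F, H ≤ K ∧ K.FiniteIndex ∧
      ∃ Q : Subgroup K, Q ≠ ⊥ ∧
        Function.Bijective
          (Monoid.Coprod.lift (H.subgroupOf K).subtype Q.subtype) := by
  classical
  let b := IsFreeGroup.basis F
  obtain ⟨S, hS⟩ := hfg
  choose word hword using b.wordProd_surjective
  let L : Finset (List (_ × Bool)) := insert [] (S.biUnion fun s => (word s).tails.toFinset)
  have hL : ∀ e w, e :: w ∈ L → w ∈ L := by
    intro e w h
    simp only [L, Finset.mem_insert, Finset.mem_biUnion, List.mem_toFinset, List.mem_tails] at h ⊢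
    obtain h | ⟨s, hs, h⟩ := h
    · simp at h
    · exact Or.inr ⟨s, hs, (List.suffix_cons e w).trans h⟩
  let ev : List (_ × Bool) → F ⧸ H := fun w => (b.wordProd w : F ⧸ H)
  let V : Finset (F ⧸ H) := L.image ev
  have hev : ∀ w ∈ L, ev w ∈ V := fun w hw => Finset.mem_image_of_mem _ hw
  have hnil : [] ∈ L := Finset.mem_insert_self _ _
  let v₀ : V := ⟨ev [], hev _ hnil⟩
  have hσ : ∀ x, ∃ σ : Equiv.Perm V, ∀ v : V, b x • v.1 ∈ V → (σ v).1 = b x • v.1 := fun x =>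
    Set.MapsTo.exists_equiv_extend_of_card_eq (s := {v : V | b x • v.1 ∈ V})
      (f := fun v => b x • v.1) (by simp) (fun v hv => hv)
      (fun v _ w _ h => Subtype.ext (MulAction.injective (b x) h))
  choose σ hσ using hσ
  have hτ : ∀ v : V, ∃ w ∈ L, ev w = v.1 ∧ (v = v₀ → w = []) := by
    intro v
    by_cases hv : v = v₀
    · exact ⟨[], hnil, by rw [hv], fun _ => rfl⟩
    · obtain ⟨w, hw, h⟩ := Finset.mem_image.1 v.2
      exact ⟨w, hw, h, fun h => absurd h hv⟩
  choose τ hτL hτ hτ₀ using hτ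
  have hfol : ∀ w ∈ L, Follows (b := b) (σ := σ) (p := Subtype.val)
      (t := fun v => b.wordProd (τ v)) hτ (b.wordProd w) v₀ := by
    intro w
    induction w with
    | nil => exact fun _ => Follows.one hτ v₀
    | cons e w ih =>
      intro hw
      have ihw := ih (hL _ _ hw)
      have hV := hev _ hw
      obtain ⟨x, _ | _⟩ := e
      · change Follows hτ ((b x)⁻¹ * b.wordProd w) v₀
        refine ihw.mul hτ ?_
        set u := wreathPerm (wreathLift b σ (edgeLabel b σ Subtype.val _ hτ)) (b.wordProd w) v₀
        have hu : u.1 = ev w := ihw.1.trans (congrArg _ (mul_one (b.wordProd w)))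
        let v : V := ⟨ev ((x, false) :: w), hV⟩
        have hxv : b x • v.1 = u.1 := by
          rw [hu]
          exact congrArg _ (mul_inv_cancel_left (b x) (b.wordProd w))
        have hv := hσ x v (hxv ▸ u.2)
        have := (follows_basis hτ hv).inv hτ
        rw [wreathPerm_wreathLift] at this
        rwa [show σ x v = u from Subtype.ext (hv.trans hxv)] at this
      · change Follows hτ (b x * b.wordProd w) v₀
        refine ihw.mul hτ (follows_basis hτ (hσ x _ ?_))
        rw [ihw.1]
        convert hV using 1
        exact congrArg _ (congrArg (b x * ·) (mul_one (b.wordProd w)))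
  refine exists_finiteIndex_free_factor hτ Subtype.val_injective
    (show b.wordProd (τ v₀) = 1 by rw [hτ₀ v₀ rfl]; rfl) (fun v => hfol _ (hτL v)) hS
    (fun s hs => ?_) ?_
  · rw [← hword s]
    refine hfol _ (Finset.mem_insert_of_mem (Finset.mem_biUnion.2 ⟨s, hs, ?_⟩))
    simp
  · by_contra hE
    have hall : ∀ x (v : V), (σ x v).1 = b x • v.1 := fun x v => by
      by_contra h
      exact hE ⟨⟨(x, v), h⟩⟩
    have hstab : ∀ g : F, ∀ v ∈ V, g • v ∈ V ∧ g⁻¹ • v ∈ V := by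
      intro g
      induction g using b.induction_on with
      | one => simp
      | of x =>
        intro v hv
        refine ⟨hall x ⟨v, hv⟩ ▸ (σ x ⟨v, hv⟩).2, ?_⟩
        have := hall x ((σ x)⁻¹ ⟨v, hv⟩)
        rw [← Equiv.Perm.mul_apply, mul_inv_cancel, Equiv.Perm.one_apply] at this
        rw [show v = _ from this, inv_smul_smul]
        exact Subtype.prop _
      | inv g ih => exact fun v hv => by simpa using (ih v hv).symm
      | mul g h ihg ihh =>
        intro v hv
        rw [mul_inv_rev, mul_smul, mul_smul]
        exact ⟨(ihg _ (ihh v hv).1).1, (ihh _ (ihg v hv).2).2⟩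
    refine Set.infinite_univ.not_finite (V.finite_toSet.subset fun c _ => ?_)
    obtain ⟨g, rfl⟩ := QuotientGroup.mk_surjective c
    have := (hstab g _ v₀.2).1
    rwa [show g • v₀.1 = (g : F ⧸ H) from congrArg _ (mul_one g)] at this
end

section
/- Let A and B be free groups of finite rank, let H be a group, and let φ_A : H → A and φ_B : H → B be injective homomorphisms whose images are finitely generated subgroups of A and B respectively. If the image of φ_A has infinite index in A, then the amalgamated free product A ∗_H B (the pushout of φ_A and φ_B in the category of groups) is not a simple group. -/
namespace FreeGroup

variable {X : Type*}

/-- A free group of rank at least two has trivial center. -/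
theorem eq_one_of_forall_commute_of [Nontrivial X] {c : FreeGroup X}
    (hc : ∀ x, Commute (of x) c) : c = 1 := by
  classical
  by_contra hne
  have hL : c.toWord ≠ [] := fun h => hne (toWord_eq_nil_iff.1 h)
  obtain ⟨y, hy₁, hy₂⟩ : ∃ y : X × Bool, y ≠ ((c.toWord.head hL).1, !(c.toWord.head hL).2) ∧
      y ≠ c.toWord.getLast hL := by
    obtain ⟨a, b, hab⟩ := exists_pair_ne X
    by_contra! h
    have h₁ := h (a, true)
    have h₂ := h (b, true)
    have h₃ := h (a, false)
    clear h
    generalize c.toWord.head hL = l at h₁ h₂ h₃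
    generalize c.toWord.getLast hL = l' at h₁ h₂ h₃
    obtain ⟨x, _ | _⟩ := l <;> obtain ⟨x', _ | _⟩ := l' <;> simp at h₁ h₂ h₃ <;> grind
  have hcomm : Commute (mk [y]) c := by
    obtain ⟨x, b⟩ := y
    cases b
    · exact (hc x).inv_left
    · exact hc x
  have hred : IsReduced (y :: (c.toWord ++ [(y.1, !y.2)])) := by
    have hc' : IsReduced c.toWord := isReduced_toWord
    unfold IsReduced at hc' ⊢
    rw [List.isChain_cons, List.isChain_append]
    refine ⟨?_, hc', by simp, ?_⟩
    · intro z hz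
      rw [List.head?_append_of_ne_nil _ hL, List.head?_eq_some_head hL, Option.mem_some] at hz
      subst hz
      intro h
      by_contra hb
      exact hy₁ (Prod.ext h (Bool.eq_not.2 hb))
    · intro z hz w hw
      rw [List.getLast?_eq_some_getLast hL, Option.mem_some] at hz
      rw [List.head?_cons, Option.mem_some] at hw
      subst hz hw
      intro h
      by_contra hb
      exact hy₂ (Prod.ext h.symm (Bool.not_not_eq.1 (Ne.symm hb)))
  have hmk : mk (y :: (c.toWord ++ [(y.1, !y.2)])) = c := by
    have : mk (y :: (c.toWord ++ [(y.1, !y.2)])) = mk [y] * c * (mk [y])⁻¹ := by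
      conv_rhs => rw [← mk_toWord (x := c)]
      simp [invRev, inv_mk, mul_mk]
    rw [this, hcomm.eq, mul_inv_cancel_right]
  have hlen := congrArg (fun w : FreeGroup X => w.toWord.length) hmk
  simp only [toWord_mk, hred.reduce_eq, List.length_cons, List.length_append] at hlen
  omega

end FreeGroup

namespace IsFreeGroup

universe u

variable {F : Type u} [Group F] [IsFreeGroup F]

theorem eq_one_of_pow_eq_one {a : F} {n : ℕ} (hn : n ≠ 0) (h : a ^ n = 1) : a = 1 := by
  apply (toFreeGroup F).injective
  rw [map_one, ← pow_eq_one_iff_left hn, ← map_pow, h, map_one]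

/-- Centralizers of nontrivial elements of free groups are cyclic. -/
theorem isCyclic_centralizer {c : F} (hc : c ≠ 1) : IsCyclic (Subgroup.centralizer {c}) := by
  let C := Subgroup.centralizer {c}
  let e := toFreeGroup C
  have hcC : c ∈ C := Subgroup.mem_centralizer_singleton_iff.2 rfl
  have hY : ¬ Nontrivial (Generators C) := fun _ => by
    refine hc (congrArg Subtype.val ((map_eq_one_iff e e.injective).1
      (FreeGroup.eq_one_of_forall_commute_of (c := e ⟨c, hcC⟩) fun x => ?_)))
    rw [← e.apply_symm_apply (FreeGroup.of x)]
    refine Commute.map (f := e) (Subtype.ext ?_)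
    exact Subgroup.mem_centralizer_singleton_iff.1 (e.symm (FreeGroup.of x)).2
  rw [not_nontrivial_iff_subsingleton] at hY
  suffices IsCyclic (FreeGroup (Generators C)) from
    isCyclic_of_surjective e.symm e.symm.surjective
  rcases isEmpty_or_nonempty (Generators C) with h | ⟨⟨x⟩⟩
  · infer_instance
  · have : Unique (Generators C) := uniqueOfSubsingleton x
    infer_instance

/-- Commutation is a transitive relation on the nontrivial elements of a free group. -/
theorem commute_trans {a b c : F} (hc : c ≠ 1) (ha : Commute a c) (hb : Commute b c) :
    Commute a b := by
  have := isCyclic_centralizer hc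
  exact congrArg Subtype.val (isMulCommutative_iff.1 inferInstance
    (⟨a, Subgroup.mem_centralizer_singleton_iff.2 ha⟩ : Subgroup.centralizer {c})
    ⟨b, Subgroup.mem_centralizer_singleton_iff.2 hb⟩)

/-- In a free group, an element commuting with one of its conjugates commutes with the
conjugating element. -/
theorem commute_of_commute_conj {q k : F} (h : Commute q (k * q * k⁻¹)) : Commute k q := by
  by_cases hq : q = 1
  · simp [hq]
  obtain ⟨d', hd'⟩ := isCyclic_centralizer hq
  obtain ⟨d, hd⟩ := d'
  have hdq : Commute d q := Subgroup.mem_centralizer_singleton_iff.1 hd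
  have hpow : ∀ x, Commute x q → ∃ i : ℤ, d ^ i = x := fun x hx => by
    obtain ⟨i, hi⟩ := hd' ⟨x, Subgroup.mem_centralizer_singleton_iff.2 hx⟩
    exact ⟨i, congrArg Subtype.val hi⟩
  obtain ⟨r, hr⟩ := hpow q rfl
  have hd1 : d ≠ 1 := by rintro rfl; simp at hr; exact hq hr.symm
  have conj_comm : ∀ {x y : F} (g : F), Commute x y → Commute (g * x * g⁻¹) (g * y * g⁻¹) :=
    fun {x y} g hxy => by simpa using hxy.map (MulAut.conj g)
  have hkq : k * q * k⁻¹ ≠ 1 := by simpa using hq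
  obtain ⟨i, hi⟩ := hpow (k * d * k⁻¹) (commute_trans hkq (conj_comm k hdq) h)
  have h' : Commute (k⁻¹ * q * k) q := by
    have := conj_comm k⁻¹ h
    simpa [mul_assoc] using this
  have hkq' : k⁻¹ * q * k ≠ 1 := by
    have := (conj_eq_one_iff (a := k⁻¹) (b := q)).not.2 hq
    simpa using this
  obtain ⟨j, hj⟩ := hpow (k⁻¹ * d * k) <| by
    refine commute_trans hkq' ?_ h'.symm
    simpa using conj_comm k⁻¹ hdq
  have hij : d ^ (i * j) = d := by
    rw [zpow_mul, hi, conj_zpow, hj]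
    group
  have hzero : ∀ n : ℤ, d ^ n = 1 → n = 0 := fun n hn => by
    by_contra hne
    refine hd1 (eq_one_of_pow_eq_one (Int.natAbs_ne_zero.2 hne) ?_)
    rcases Int.natAbs_eq n with h | h <;> rw [h] at hn <;> simpa using hn
  have hij1 : i * j = 1 := by
    have := hzero (i * j - 1) (by rw [zpow_sub_one, hij, mul_inv_cancel])
    omega
  have key : ∀ x, Commute x d → Commute x q := fun x hx => by
    rw [← hr]; exact hx.zpow_right r
  rcases Int.eq_one_or_neg_one_of_mul_eq_one hij1 with rfl | rfl
  · refine key k ?_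
    rw [zpow_one, eq_mul_inv_iff_mul_eq] at hi
    exact hi.symm
  · have h2 : Commute (k ^ 2) q := by
      refine key _ ?_
      have e1 : k * d = d⁻¹ * k := by rw [← zpow_neg_one, hi]; group
      have e2 : k * d⁻¹ = d * k := by
        have := congrArg (fun t => d * t * d⁻¹) e1
        simpa [mul_assoc] using this.symm
      change k ^ 2 * d = d * k ^ 2
      rw [pow_two, mul_assoc, e1, ← mul_assoc, e2, mul_assoc]
    by_cases hk : k ^ 2 = 1
    · rw [eq_one_of_pow_eq_one two_ne_zero hk]
      exact Commute.one_left q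
    · exact commute_trans hk ((Commute.refl k).pow_right 2) h2.symm

/-- Nontrivial subgroups of a nonabelian free group that are normalized by a common subgroup `K`
of finite index containing both of them intersect nontrivially. -/
theorem inf_ne_bot {a b : F} (hab : ¬ Commute a b) {K P Q : Subgroup F} [K.FiniteIndex]
    (hPK : P ≤ K) (hQK : Q ≤ K) (hP : ∀ k ∈ K, ∀ p ∈ P, k * p * k⁻¹ ∈ P)
    (hQ : ∀ k ∈ K, ∀ q ∈ Q, k * q * k⁻¹ ∈ Q) (hP1 : P ≠ ⊥) (hQ1 : Q ≠ ⊥) : P ⊓ Q ≠ ⊥ := by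
  intro hPQ
  obtain ⟨p, hp, hp1⟩ := P.bot_or_exists_ne_one.resolve_left hP1
  obtain ⟨q, hq, hq1⟩ := Q.bot_or_exists_ne_one.resolve_left hQ1
  have hcomm : ∀ y ∈ Q, Commute y p := fun y hy => by
    have : p * y * p⁻¹ * y⁻¹ ∈ P ⊓ Q := by
      refine ⟨?_, Q.mul_mem (hQ p (hPK hp) y hy) (Q.inv_mem hy)⟩
      have := P.mul_mem hp (hP y (hQK hy) p⁻¹ (P.inv_mem hp))
      simpa [mul_assoc] using this
    rw [hPQ, Subgroup.mem_bot, mul_inv_eq_one, mul_inv_eq_iff_eq_mul] at this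
    exact this.symm
  have hK : ∀ k ∈ K, Commute k q := fun k hk =>
    commute_of_commute_conj (commute_trans hp1 (hcomm q hq) (hcomm _ (hQ k hk q hq)))
  have hall : ∀ x : F, Commute x q := fun x => by
    obtain ⟨n, hn, -, hx⟩ := Subgroup.exists_pow_mem_of_index_ne_zero
      (Subgroup.FiniteIndex.index_ne_zero (H := K)) x
    by_cases h1 : x ^ n = 1
    · rw [eq_one_of_pow_eq_one hn.ne' h1]
      exact Commute.one_left q
    · exact commute_trans h1 ((Commute.refl x).pow_right n) (hK _ hx).symm
  exact hab (commute_trans hq1 (hall a) (hall b))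

/-- The normal core of a nontrivial subgroup whose normalizer has finite index is nontrivial. -/
theorem normalCore_ne_bot {M G : Subgroup F} [G.FiniteIndex]
    (hMG : ∀ g ∈ G, ∀ m ∈ M, g * m * g⁻¹ ∈ M) (hM : M ≠ ⊥) : M.normalCore ≠ ⊥ := by
  obtain ⟨m, hm, hm1⟩ := M.bot_or_exists_ne_one.resolve_left hM
  by_cases hab : ∀ a b : F, Commute a b
  · refine fun h => hm1 ((Subgroup.mem_bot (G := F)).1 (h ▸ fun b => ?_))
    rwa [(hab b m).eq, mul_inv_cancel_right]
  push Not at hab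
  obtain ⟨a, b, hab⟩ := hab
  let K := G.normalCore
  have hKG : K ≤ G := G.normalCore_le
  have pow_mem : ∀ x : F, x ≠ 1 → ∃ n : ℕ, x ^ n ∈ K ∧ x ^ n ≠ 1 := fun x hx => by
    obtain ⟨n, hn, -, h⟩ := Subgroup.exists_pow_mem_of_index_ne_zero
      (Subgroup.FiniteIndex.index_ne_zero (H := K)) x
    exact ⟨n, h, fun h => hx (eq_one_of_pow_eq_one hn.ne' h)⟩
  let D : F → Subgroup F := fun g => (M ⊓ K).map (MulAut.conj g).toMonoidHom
  have mem_D : ∀ g z, z ∈ D g ↔ g⁻¹ * z * g ∈ M ⊓ K := fun g z => by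
    constructor
    · rintro ⟨y, hy, rfl⟩
      simpa [mul_assoc] using hy
    · intro h
      exact ⟨_, h, by simp [mul_assoc]⟩
  have hMK : ∀ k ∈ K, ∀ z ∈ M ⊓ K, k * z * k⁻¹ ∈ M ⊓ K := fun k hk z hz =>
    ⟨hMG k (hKG hk) z hz.1, K.mul_mem (K.mul_mem hk hz.2) (K.inv_mem hk)⟩
  have hDK : ∀ g, D g ≤ K := fun g z hz => by
    have := Subgroup.Normal.conj_mem inferInstance _ ((mem_D g z).1 hz).2 g
    simpa [mul_assoc] using this
  have hDn : ∀ g, ∀ k ∈ K, ∀ z ∈ D g, k * z * k⁻¹ ∈ D g := fun g k hk z hz => by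
    rw [mem_D] at hz ⊢
    have hk' : g⁻¹ * k * g ∈ K := by
      have := Subgroup.Normal.conj_mem inferInstance k hk g⁻¹
      simpa using this
    simpa [mul_assoc] using hMK _ hk' _ hz
  have hD1 : ∀ g, D g ≠ ⊥ := fun g => by
    obtain ⟨n, hn, hn1⟩ := pow_mem m hm1
    refine (Subgroup.map_eq_bot_iff_of_injective _ (MulAut.conj g).injective).not.2 fun h => hn1 ?_
    rw [← Subgroup.mem_bot, ← h]
    exact ⟨M.pow_mem hm n, hn⟩
  have hfin : ∀ T : Finset (F ⧸ K), ∃ E : Subgroup F, E ≤ K ∧ (∀ k ∈ K, ∀ z ∈ E, k * z * k⁻¹ ∈ E) ∧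
      E ≠ ⊥ ∧ ∀ c ∈ T, E ≤ D c.out := fun T => by
    classical
    induction T using Finset.induction_on with
    | empty =>
      refine ⟨D 1, hDK 1, hDn 1, hD1 1, by simp⟩
    | insert c T _ ih =>
      obtain ⟨E, hEK, hEn, hE1, hE⟩ := ih
      refine ⟨E ⊓ D c.out, inf_le_left.trans hEK,
        fun k hk z hz => ⟨hEn k hk z hz.1, hDn _ k hk z hz.2⟩,
        inf_ne_bot hab hEK (hDK _) hEn (hDn _) hE1 (hD1 _), fun c' hc' => ?_⟩
      rcases Finset.mem_insert.1 hc' with rfl | h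
      · exact inf_le_right
      · exact inf_le_left.trans (hE c' h)
  have : Fintype (F ⧸ K) := Fintype.ofFinite _
  obtain ⟨E, -, -, hE1, hE⟩ := hfin Finset.univ
  refine ne_bot_of_le_ne_bot hE1 fun z hz g => ?_
  have h := (mem_D _ z).1 (hE (g⁻¹ : F) (Finset.mem_univ _) hz)
  obtain ⟨k, hk⟩ := QuotientGroup.mk_out_eq_mul K g⁻¹
  rw [hk] at h
  have := (hMK k k.2 _ h).1
  simpa [mul_assoc] using this

end IsFreeGroup

namespace FreeGroup

variable {X : Type*}

/-- Permutations `σ x` of `S` together with `H`-valued weights `κ x s` extend to an action of the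
free group on `S` and a cocycle. -/
theorem exists_cocycle {S H : Type*} [Group H] (σ : X → Equiv.Perm S) (κ : X → S → H) :
    ∃ c : FreeGroup X → S → H, (∀ x, c (of x) = κ x) ∧
      ∀ v w s, c (v * w) s = c v (lift σ w s) * c w s := by
  let Θ : FreeGroup X →* Equiv.Perm (S × H) :=
    lift fun x => Equiv.prodShear (σ x) fun s => Equiv.mulLeft (κ x s)
  have hΘ : ∀ w, ∃ k : S → H, ∀ s h, Θ w (s, h) = (lift σ w s, k s * h) := fun w => by
    induction w using FreeGroup.induction_on with
    | C1 => exact ⟨1, by simp⟩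
    | of x => exact ⟨κ x, by simp [Θ]⟩
    | inv_of x ih =>
      obtain ⟨k, hk⟩ := ih
      refine ⟨fun s => (k ((lift σ (of x)⁻¹) s))⁻¹, fun s h => ?_⟩
      rw [_root_.map_inv Θ, Equiv.Perm.inv_eq_iff_eq, hk]
      simp
    | mul v w hv hw =>
      obtain ⟨k, hk⟩ := hv
      obtain ⟨l, hl⟩ := hw
      exact ⟨fun s => k (lift σ w s) * l s, fun s h => by simp [hk, hl, mul_assoc]⟩
  choose c hc using hΘ
  refine ⟨c, fun x => funext fun s => ?_, fun v w s => ?_⟩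
  · have := hc (of x) s 1
    simpa [Θ] using this.symm
  · have := hc (v * w) s 1
    rw [_root_.map_mul, Equiv.Perm.mul_apply, hc, hc] at this
    simpa using (congrArg Prod.snd this).symm

/-- **Marshall Hall's theorem**: a finitely generated subgroup of a free group is a retract of a
subgroup of finite index. -/
theorem exists_finiteIndex_retract {H : Subgroup (FreeGroup X)} (hH : H.FG) :
    ∃ (K : Subgroup (FreeGroup X)) (hHK : H ≤ K) (ρ : K →* H),
      K.FiniteIndex ∧ ∀ h : H, ρ ⟨h, hHK h.2⟩ = h := by
  classical
  obtain ⟨T, hT⟩ := hH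
  let β : FreeGroup X ⧸ H := ((1 : FreeGroup X) : FreeGroup X ⧸ H)
  let S : Set (FreeGroup X ⧸ H) :=
    insert β (⋃ t ∈ T, {q | ∃ v ∈ t.toWord.tails, q = mk v • β})
  have hSfin : S.Finite := by
    refine Set.Finite.insert _ (Set.Finite.biUnion T.finite_toSet fun t _ => ?_)
    refine ((t.toWord.tails.toFinset.finite_toSet).image fun v => mk v • β).subset ?_
    rintro q ⟨v, hv, rfl⟩
    exact ⟨v, by simpa using hv, rfl⟩
  have : Finite S := hSfin
  let b : S := ⟨β, Set.mem_insert _ _⟩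
  have hsuf : ∀ t ∈ T, ∀ v, v <:+ t.toWord → mk v • β ∈ S := fun t ht v hv =>
    Set.mem_insert_of_mem _ (Set.mem_biUnion ht ⟨v, (List.mem_tails _ _).2 hv, rfl⟩)
  -- Complete the partial action of each generator on `S` to a permutation of `S`.
  let e : ∀ x : X, {s : S // of x • s.1 ∈ S} ≃ {s : S // (of x)⁻¹ • s.1 ∈ S} := fun x =>
    { toFun := fun s => ⟨⟨of x • s.1.1, s.2⟩, by simp⟩
      invFun := fun s => ⟨⟨(of x)⁻¹ • s.1.1, s.2⟩, by simp⟩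
      left_inv := fun s => by simp
      right_inv := fun s => by simp }
  let σ : X → Equiv.Perm S := fun x => (e x).extendSubtype
  have hσ : ∀ x (s : S), of x • s.1 ∈ S → (σ x s).1 = of x • s.1 := fun x s hs => by
    exact congrArg Subtype.val ((e x).extendSubtype_apply_of_mem s hs)
  -- A transversal sending the base point to `1`.
  let τ : FreeGroup X ⧸ H → FreeGroup X := fun q => q.out * β.out⁻¹
  have hτβ : τ β = 1 := mul_inv_cancel _
  have hβ : β.out ∈ H := by
    have : ((β.out : FreeGroup X) : FreeGroup X ⧸ H) = β := Quotient.out_eq' β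
    simpa using QuotientGroup.eq.1 this.symm
  have hτ : ∀ q, (τ q : FreeGroup X ⧸ H) = q := fun q => by
    rw [QuotientGroup.mk_mul_of_mem _ (H.inv_mem hβ)]
    exact Quotient.out_eq' q
  have hτmem : ∀ w q, (τ (w • q))⁻¹ * w * τ q ∈ H := fun w q => by
    rw [mul_assoc, ← QuotientGroup.eq, hτ]
    conv_lhs => rw [← hτ q]
    rfl
  obtain ⟨c, hcκ, hc⟩ := exists_cocycle σ fun x s =>
    (⟨(τ (of x • s.1))⁻¹ * of x * τ s.1, hτmem _ _⟩ : H)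
  let A : FreeGroup X →* Equiv.Perm S := lift σ
  have hc1 : ∀ s, c 1 s = 1 := fun s => by simpa using hc 1 1 s
  have hletter : ∀ (y : X × Bool) (s : S), mk [y] • s.1 ∈ S →
      (A (mk [y]) s).1 = mk [y] • s.1 ∧
        (c (mk [y]) s : FreeGroup X) = (τ (mk [y] • s.1))⁻¹ * mk [y] * τ s.1 := by
    rintro ⟨x, _ | _⟩ s hs
    · have hmk : (mk [(x, false)] : FreeGroup X) = (of x)⁻¹ := rfl
      rw [hmk] at hs ⊢
      let s' : S := ⟨_, hs⟩
      have hs' : of x • s'.1 = s.1 := smul_inv_smul _ _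
      have h₁ : A (of x) s' = s := Subtype.ext <| by
        rw [← hs']
        simpa [A] using hσ x s' (by rw [hs']; exact s.2)
      have h₂ : A (of x)⁻¹ s = s' := by
        rw [_root_.map_inv, Equiv.Perm.inv_eq_iff_eq, h₁]
      refine ⟨congrArg Subtype.val h₂, ?_⟩
      have h₃ := hc (of x) (of x)⁻¹ s
      rw [mul_inv_cancel, hc1, h₂, hcκ] at h₃
      rw [eq_inv_of_mul_eq_one_right h₃.symm]
      simp only [hs', InvMemClass.coe_inv, mul_inv_rev, inv_inv, mul_assoc]
      rfl
    · have hmk : (mk [(x, true)] : FreeGroup X) = of x := rfl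
      rw [hmk] at hs ⊢
      exact ⟨by simpa [A] using hσ x s hs, by rw [hcκ]⟩
  have hword : ∀ v : List (X × Bool), (∀ u, u <:+ v → mk u • β ∈ S) →
      (A (mk v) b).1 = mk v • β ∧ (c (mk v) b : FreeGroup X) = (τ (mk v • β))⁻¹ * mk v := by
    intro v
    induction v with
    | nil =>
      intro _
      simp [← one_eq_mk, hc1, hτβ, b]
    | cons y v ih =>
      intro h
      obtain ⟨h₁, h₂⟩ := ih fun u hu => h u (hu.trans (List.suffix_cons y v))
      have hmk : (mk (y :: v) : FreeGroup X) = mk [y] * mk v := by simp [mul_mk]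
      have hy : mk [y] • (A (mk v) b).1 ∈ S := by
        rw [h₁, ← mul_smul, ← hmk]
        exact h _ List.suffix_rfl
      obtain ⟨h₃, h₄⟩ := hletter y _ hy
      rw [hmk]
      refine ⟨by rw [_root_.map_mul, Equiv.Perm.mul_apply, h₃, h₁, mul_smul], ?_⟩
      rw [hc, Subgroup.coe_mul, h₄, h₂, h₁, mul_smul]
      group
  have hcmul : ∀ v w, A w b = b → c (v * w) b = c v b * c w b := fun v w hw => by
    rw [hc, show lift σ w b = b from hw]
  let L : Subgroup (FreeGroup X) :=
    { carrier := {w | A w b = b ∧ (c w b : FreeGroup X) = w}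
      one_mem' := by simp [hc1]
      mul_mem' := fun {v w} hv hw => ⟨by rw [_root_.map_mul, Equiv.Perm.mul_apply, hw.1, hv.1], by
        rw [hcmul v w hw.1, Subgroup.coe_mul, hv.2, hw.2]⟩
      inv_mem' := fun {w} hw => by
        have h : A w⁻¹ b = b := by rw [_root_.map_inv, Equiv.Perm.inv_eq_iff_eq, hw.1]
        refine ⟨h, ?_⟩
        have := hcmul w w⁻¹ h
        rw [mul_inv_cancel, hc1] at this
        rw [eq_inv_of_mul_eq_one_right this.symm, Subgroup.coe_inv, hw.2] }
  have hHL : H ≤ L := by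
    rw [← hT, Subgroup.closure_le]
    intro t ht
    obtain ⟨h₁, h₂⟩ := hword t.toWord (hsuf t ht)
    have htβ : t • β = β := by
      have : t ∈ H := hT ▸ Subgroup.subset_closure ht
      exact (QuotientGroup.eq.2 (by simpa using this)).symm
    rw [mk_toWord, htβ] at h₁ h₂
    exact ⟨Subtype.ext h₁, by rw [h₂, hτβ]; simp⟩
  let K := (MulAction.stabilizer (Equiv.Perm S) b).comap A
  have hK : ∀ w, w ∈ K ↔ A w b = b := fun w => Iff.rfl
  refine ⟨K, fun h hh => (hHL hh).1, MonoidHom.mk' (fun w => c w b) fun v w => hcmul v w w.2,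
    ⟨?_⟩, fun h => Subtype.ext (hHL h.2).2⟩
  rw [Subgroup.index_comap]
  have := Subgroup.isFiniteRelIndex_of_finiteIndex (H := MulAction.stabilizer (Equiv.Perm S) b)
    (K := A.range)
  exact Subgroup.relIndex_ne_zero

end FreeGroup

namespace IsFreeGroup

/-- A finitely generated subgroup of infinite index in a free group intersects some nontrivial
normal subgroup trivially. -/
theorem exists_normal_inf_eq_bot {F : Type*} [Group F] [IsFreeGroup F] {H : Subgroup F} (hH : H.FG)
    (hinf : ¬ H.FiniteIndex) : ∃ N : Subgroup F, N.Normal ∧ N ≠ ⊥ ∧ N ⊓ H = ⊥ := by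
  let e := toFreeGroup F
  let H' := H.map e.toMonoidHom
  obtain ⟨K, hHK, ρ, hK, hρ⟩ := FreeGroup.exists_finiteIndex_retract (H := H') <| by
    rw [← Group.fg_iff_subgroup_fg] at hH ⊢
    exact Group.fg_of_surjective (e.toMonoidHom.subgroupMap_surjective H)
  let M := ρ.ker.map K.subtype
  have hM : M ≠ ⊥ := fun h => hinf <| by
    have hKH : K ≤ H' := fun w hw => by
      have hk : (⟨w, hw⟩ * ⟨ρ ⟨w, hw⟩, hHK (ρ ⟨w, hw⟩).2⟩⁻¹ : K) ∈ ρ.ker := by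
        rw [MonoidHom.mem_ker, map_mul, map_inv, hρ, mul_inv_cancel]
      have hk' := Subgroup.mem_map_of_mem K.subtype hk
      rw [show ρ.ker.map K.subtype = ⊥ from h, Subgroup.mem_bot] at hk'
      have := mul_inv_eq_one.1 (by simpa using hk')
      exact this ▸ (ρ ⟨w, hw⟩).2
    have : H'.FiniteIndex := Subgroup.finiteIndex_of_le hKH
    refine ⟨?_⟩
    rw [← Subgroup.index_map_equiv H e]
    exact this.index_ne_zero
  have hMK : ∀ g ∈ K, ∀ m ∈ M, g * m * g⁻¹ ∈ M := by
    rintro g hg _ ⟨m, hm, rfl⟩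
    exact ⟨⟨g, hg⟩ * m * ⟨g, hg⟩⁻¹, ρ.normal_ker.conj_mem m hm _, by simp⟩
  refine ⟨M.normalCore.comap e.toMonoidHom, inferInstance, fun h => normalCore_ne_bot hMK hM ?_,
    eq_bot_iff.2 fun x hx => ?_⟩
  · rw [← Subgroup.map_comap_eq_self_of_surjective (f := e.toMonoidHom) e.surjective M.normalCore,
      h, Subgroup.map_bot]
  · obtain ⟨m, hm, hmx⟩ := M.normalCore_le hx.1
    have hxH : e x ∈ H' := Subgroup.mem_map_of_mem _ hx.2
    have h1 := hρ ⟨e x, hxH⟩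
    rw [show (⟨e x, hHK hxH⟩ : K) = m from Subtype.ext hmx.symm, MonoidHom.mem_ker.1 hm] at h1
    rw [Subgroup.mem_bot, ← map_eq_one_iff e e.injective]
    exact (congrArg Subtype.val h1).symm

end IsFreeGroup

universe u v w

/-- Two groups amalgamated along injective homomorphisms embed compatibly in a common group. -/
theorem Monoid.exists_amalgam {A : Type u} {B : Type v} {H : Type w} [Group A] [Group B] [Group H]
    (φA : H →* A) (φB : H →* B) (hA : Function.Injective φA) (hB : Function.Injective φB) :
    ∃ (P : Type (max u v w)) (_ : Group P) (f : A →* P) (g : B →* P),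
      Function.Injective f ∧ Function.Injective g ∧ ∀ h, f (φA h) = g (φB h) := by
  let G : Bool → Type (max u v) := fun
    | true => ULift.{v} A
    | false => ULift.{u} B
  let inst : ∀ i, Group (G i) := fun
    | true => inferInstanceAs (Group (ULift.{v} A))
    | false => inferInstanceAs (Group (ULift.{u} B))
  let φ : ∀ i, H →* G i := fun
    | true => (MulEquiv.ulift (α := A)).symm.toMonoidHom.comp φA
    | false => (MulEquiv.ulift (α := B)).symm.toMonoidHom.comp φB
  have hφ : ∀ i, Function.Injective (φ i) := by
    rintro (_ | _)
    · exact (MulEquiv.ulift (α := B)).symm.injective.comp hB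
    · exact (MulEquiv.ulift (α := A)).symm.injective.comp hA
  refine ⟨PushoutI φ, inferInstance,
    (PushoutI.of (φ := φ) true).comp (MulEquiv.ulift (α := A)).symm.toMonoidHom,
    (PushoutI.of (φ := φ) false).comp (MulEquiv.ulift (α := B)).symm.toMonoidHom,
    (PushoutI.of_injective hφ true).comp (MulEquiv.ulift (α := A)).symm.injective,
    (PushoutI.of_injective hφ false).comp (MulEquiv.ulift (α := B)).symm.injective, fun h => ?_⟩
  exact (PushoutI.of_apply_eq_base φ true h).trans (PushoutI.of_apply_eq_base φ false h).symm

/-- The universal property of the amalgamated free product, as a quotient of the free product. -/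
theorem Monoid.exists_amalgam_lift {A B H D : Type*} [Group A] [Group B] [Group H] [Group D]
    (φA : H →* A) (φB : H →* B) (f : A →* D) (g : B →* D) (hfg : ∀ h, f (φA h) = g (φB h)) :
    ∃ ψ : (Monoid.Coprod A B ⧸ Subgroup.normalClosure
          {x | ∃ h : H, x = Monoid.Coprod.inl (φA h) * (Monoid.Coprod.inr (φB h))⁻¹}) →* D,
      ∀ a, ψ (QuotientGroup.mk (Monoid.Coprod.inl a)) = f a := by
  refine ⟨QuotientGroup.lift _ (Monoid.Coprod.lift f g) ?_, fun a => ?_⟩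
  · refine Subgroup.normalClosure_le_normal (N := (Monoid.Coprod.lift f g).ker) ?_
    rintro _ ⟨h, rfl⟩
    simp [MonoidHom.mem_ker, hfg]
  · simp

/-- An amalgamated free product is not simple if some homomorphism from it to another group kills a
nontrivial element of a factor but not the whole factor. -/
theorem Monoid.not_isSimpleGroup_amalgam {A B H D : Type*} [Group A] [Group B] [Group H] [Group D]
    (φA : H →* A) (φB : H →* B) (hA : Function.Injective φA) (hB : Function.Injective φB)
    (f : A →* D) (g : B →* D) (hfg : ∀ h, f (φA h) = g (φB h)) {a : A} (ha : a ≠ 1)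
    (hfa : f a = 1) {d : A} (hd : f d ≠ 1) :
    ¬ IsSimpleGroup
        (Monoid.Coprod A B ⧸ Subgroup.normalClosure
          {x | ∃ h : H, x = Monoid.Coprod.inl (φA h) * (Monoid.Coprod.inr (φB h))⁻¹}) := by
  intro hsimple
  obtain ⟨P, _, i, j, hi, -, hij⟩ := exists_amalgam φA φB hA hB
  obtain ⟨η, hη⟩ := exists_amalgam_lift φA φB i j hij
  obtain ⟨ψ, hψ⟩ := exists_amalgam_lift φA φB f g hfg
  rcases ψ.normal_ker.eq_bot_or_eq_top with h | h
  · have h1 := (MonoidHom.ker_eq_bot_iff ψ).1 h (((hψ a).trans hfa).trans (map_one ψ).symm)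
    exact ha ((map_eq_one_iff i hi).1 (by rw [← hη, h1, map_one]))
  · refine hd ?_
    rw [← hψ, ← MonoidHom.mem_ker, h]
    trivial

/-- If `A`, `B` are free groups of finite rank, `H` embeds into both with finitely
generated images, and the image of `H` in `A` has infinite index, then the
amalgamated free product `A ∗_H B` (the quotient of `A ∗ B` by the normal closure
of the elements `φ_A h * (φ_B h)⁻¹`) is not simple. -/
theorem stmt_8 {A B H : Type*} [Group A] [Group B] [Group H]
    [IsFreeGroup A] [IsFreeGroup B]
    [Finite (IsFreeGroup.Generators A)] [Finite (IsFreeGroup.Generators B)]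
    (φA : H →* A) (φB : H →* B)
    (hA : Function.Injective φA) (hB : Function.Injective φB)
    (hfgA : φA.range.FG) (hfgB : φB.range.FG)
    (hinf : Infinite (A ⧸ φA.range)) :
    ¬ IsSimpleGroup
        (Monoid.Coprod A B ⧸ Subgroup.normalClosure
          {x | ∃ h : H, x = Monoid.Coprod.inl (φA h) * (Monoid.Coprod.inr (φB h))⁻¹}) := by
  rcases subsingleton_or_nontrivial H with hH | hH
  · have : Nonempty (IsFreeGroup.Generators A) := by
      by_contra hempty
      rw [not_nonempty_iff] at hempty
      have : Subsingleton A := (IsFreeGroup.toFreeGroup A).injective.subsingleton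
      exact not_finite (A ⧸ φA.range)
    obtain ⟨x⟩ := this
    let f : A →* Multiplicative (ZMod 2) := IsFreeGroup.lift fun _ => Multiplicative.ofAdd 1
    have hfx : f (IsFreeGroup.of x) = Multiplicative.ofAdd 1 := IsFreeGroup.lift_of _ x
    have hfx1 : f (IsFreeGroup.of x) ≠ 1 := by rw [hfx]; decide
    refine Monoid.not_isSimpleGroup_amalgam φA φB hA hB f 1 (fun h => ?_)
      (a := IsFreeGroup.of x ^ 2) (fun h => ?_) ?_ hfx1
    · rw [Subsingleton.elim h 1, map_one, map_one, map_one, map_one]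
    · rw [IsFreeGroup.eq_one_of_pow_eq_one two_ne_zero h, map_one] at hfx1
      exact hfx1 rfl
    · rw [map_pow, hfx]
      decide
  · obtain ⟨N, _, hN, hNH⟩ := IsFreeGroup.exists_normal_inf_eq_bot hfgA fun _ =>
      not_finite (A ⧸ φA.range)
    obtain ⟨z, hzN, hz⟩ := N.bot_or_exists_ne_one.resolve_left hN
    obtain ⟨h, hh⟩ := exists_ne (1 : H)
    let π := QuotientGroup.mk' N
    have hπ : Function.Injective (π.comp φA) := by
      rw [injective_iff_map_eq_one]
      intro k hk
      have hkN : φA k ∈ N ⊓ φA.range := ⟨(QuotientGroup.eq_one_iff _).1 hk, k, rfl⟩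
      rw [hNH, Subgroup.mem_bot] at hkN
      exact (map_eq_one_iff φA hA).1 hkN
    obtain ⟨P, _, i, j, hi, -, hij⟩ := Monoid.exists_amalgam (π.comp φA) φB hπ hB
    refine Monoid.not_isSimpleGroup_amalgam φA φB hA hB (i.comp π) j hij hz ?_ (d := φA h) ?_
    · rw [MonoidHom.comp_apply, show π z = 1 from (QuotientGroup.eq_one_iff z).2 hzN, map_one]
    · exact fun h1 => hh ((map_eq_one_iff _ hπ).1 ((map_eq_one_iff i hi).1 h1))
end
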